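/- arXiv:funct-an/9712002 — 4 statements merged into one kernel-verified Lean document; each statement's English description precedes it below -/
import Mathlib

section
/- Let A be a unital purely infinite simple C*-algebra, and let a₁, …, a_n ∈ A be positive elements with ‖a_j‖ = 1 for all j. Then for every ε > 0 there exist nonzero mutually orthogonal projections p₁, …, p_n ∈ A (p_j·p_k = 0 for j ≠ k) such that ‖p_j·a_j − p_j‖ < ε for 1 ≤ j ≤ n. -/
section PurelyInfinite

variable {A : Type*} [CStarAlgebra A]

/-- A left invertible element of a C*-algebra can be rescaled on the right to an isometry. -/
lemma exists_mul_isometry_of_mul_eq_one {a w : A} (h : a * w = 1) :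
    ∃ s : A, star (w * s) * (w * s) = 1 := by
  let _ : PartialOrder A := CStarAlgebra.spectralOrder A
  have : StarOrderedRing A := CStarAlgebra.spectralOrderedRing A
  have hle : (1 : A) ≤ (‖a‖ ^ 2) • (star w * w) := by
    calc (1 : A) = star w * (star a * a) * w := by
          rw [show star w * (star a * a) * w = star (a * w) * (a * w) by
            simp only [star_mul, mul_assoc], h]
          simp
      _ ≤ star w * (algebraMap ℝ A (‖a‖ ^ 2)) * w :=
          star_left_conjugate_le_conjugate CStarAlgebra.star_mul_le_algebraMap_norm_sq w
      _ = _ := by simp [Algebra.algebraMap_eq_smul_one]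
  have hu : IsUnit (star w * w) := by
    have h1 : IsUnit ((‖a‖ ^ 2) • (star w * w)) := CStarAlgebra.isUnit_of_le 1 hle
    rw [Algebra.smul_def] at h1
    exact ((Algebra.commute_algebraMap_left _ _).isUnit_mul_iff.1 h1).2
  have hnn : 0 ≤ star w * w := star_mul_self_nonneg w
  refine ⟨(star w * w) ^ (-(1 / 2) : ℝ), ?_⟩
  rw [star_mul, CFC.rpow_nonneg.isSelfAdjoint.star_eq]
  simpa only [mul_assoc] using
    CFC.conjugate_rpow_neg_one_half (star w * w) (IsStrictlyPositive.iff_of_unital.2 ⟨hnn, hu⟩)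

/-- A nontrivial algebra over which every nonzero `x` admits `a * x * b = 1` has zero divisors,
unless it consists of scalars. -/
lemma exists_mul_eq_zero_of_forall_exists_mul_mul_eq_one
    (hnontriv : ∃ x : A, ∀ c : ℂ, x ≠ c • (1 : A))
    (hpi : ∀ x : A, x ≠ 0 → ∃ a b : A, a * x * b = 1) :
    ∃ s t : A, s ≠ 0 ∧ t ≠ 0 ∧ s * t = 0 := by
  by_contra! hdom
  obtain ⟨x, hx⟩ := hnontriv
  have : Nontrivial A := ⟨x, 0, by simpa using hx 0⟩
  obtain ⟨k, hk⟩ := spectrum.nonempty x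
  refine hk ?_
  have hne : algebraMap ℂ A k - x ≠ 0 := by
    rw [sub_ne_zero, Algebra.algebraMap_eq_smul_one]
    exact (hx k).symm
  obtain ⟨a, b, hab⟩ := hpi _ hne
  set y := algebraMap ℂ A k - x
  have ha : a ≠ 0 := by rintro rfl; simp at hab
  have hb : b ≠ 0 := by rintro rfl; simp at hab
  have h1 : b * a * y = 1 := by
    by_contra h
    refine hdom (b * a * y - 1) b (sub_ne_zero.2 h) hb ?_
    rw [sub_mul, mul_assoc, mul_assoc, ← mul_assoc a, hab]; simp
  have h2 : y * (b * a) = 1 := by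
    by_contra h
    refine hdom a (y * (b * a) - 1) ha (sub_ne_zero.2 h) ?_
    rw [mul_sub, ← mul_assoc, ← mul_assoc, hab]; simp
  exact ⟨⟨y, b * a, h2, h1⟩, rfl⟩

/-- In a purely infinite simple C*-algebra every nonzero right ideal contains an isometry. -/
lemma exists_mul_isometry
    (hpi : ∀ x : A, x ≠ 0 → ∃ a b : A, a * x * b = 1) {c : A} (hc : c ≠ 0) :
    ∃ s : A, star (c * s) * (c * s) = 1 := by
  obtain ⟨a, b, hab⟩ := hpi c hc
  rw [mul_assoc] at hab
  obtain ⟨s, hs⟩ := exists_mul_isometry_of_mul_eq_one hab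
  exact ⟨b * s, by simpa only [mul_assoc] using hs⟩

/-- Two nonzero right ideals contain nonzero elements with orthogonal ranges. -/
lemma exists_star_mul_mul_eq_zero
    (hnontriv : ∃ x : A, ∀ c : ℂ, x ≠ c • (1 : A))
    (hpi : ∀ x : A, x ≠ 0 → ∃ a b : A, a * x * b = 1) {b c : A} (hb : b ≠ 0) (hc : c ≠ 0) :
    ∃ s t : A, b * s ≠ 0 ∧ c * t ≠ 0 ∧ star (b * s) * (c * t) = 0 := by
  obtain ⟨z, hz⟩ := exists_mul_isometry hpi hb
  obtain ⟨w, hw⟩ := exists_mul_isometry hpi hc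
  have key : ∃ s t : A, s ≠ 0 ∧ t ≠ 0 ∧ s * (star (b * z) * (c * w)) * t = 0 := by
    obtain ⟨x, y, hx, hy, hxy⟩ := exists_mul_eq_zero_of_forall_exists_mul_mul_eq_one hnontriv hpi
    by_cases hd : star (b * z) * (c * w) = 0
    · exact ⟨x, y, hx, hy, by rw [hd, mul_zero, zero_mul]⟩
    obtain ⟨p, q, hpq⟩ := hpi _ hd
    generalize star (b * z) * (c * w) = d at hpq
    refine ⟨x * p, q * y, fun h => hx ?_, fun h => hy ?_, ?_⟩
    · rw [← mul_one x, ← hpq, ← mul_assoc, ← mul_assoc, h]; simp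
    · rw [← one_mul y, ← hpq, mul_assoc, h]; simp
    · rw [show x * p * d * (q * y) = x * (p * d * q) * y by simp only [mul_assoc], hpq, mul_one,
        hxy]
  obtain ⟨s, t, hs, ht, hst⟩ := key
  refine ⟨z * star s, w * t, fun h => hs ?_, fun h => ht ?_, ?_⟩
  · rw [← star_eq_zero, ← one_mul (star s), ← hz, mul_assoc, mul_assoc b, h, mul_zero]
  · rw [← one_mul t, ← hw, mul_assoc, mul_assoc c, h, mul_zero]
  · rw [← hst]; simp only [star_mul, star_star, mul_assoc]

/-- Finitely many nonzero right ideals contain nonzero elements with pairwise orthogonal ranges. -/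
lemma exists_pairwise_star_mul_mul_eq_zero {ι : Type*} [Finite ι]
    (hnontriv : ∃ x : A, ∀ c : ℂ, x ≠ c • (1 : A))
    (hpi : ∀ x : A, x ≠ 0 → ∃ a b : A, a * x * b = 1) (b : ι → A) (hb : ∀ j, b j ≠ 0) :
    ∃ z : ι → A, (∀ j, b j * z j ≠ 0) ∧
      ∀ i j, i ≠ j → star (b i * z i) * (b j * z j) = 0 := by
  classical
  have := Fintype.ofFinite ι
  suffices H : ∀ S : Finset (ι × ι), ∃ z : ι → A, (∀ j, b j * z j ≠ 0) ∧
      ∀ i j, (i, j) ∈ S → i ≠ j → star (b i * z i) * (b j * z j) = 0 by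
    simpa using H Finset.univ
  intro S
  induction S using Finset.induction_on with
  | empty => exact ⟨1, by simpa using hb, by simp⟩
  | insert q S _ ih =>
    obtain ⟨z, hz, hS⟩ := ih
    obtain ⟨k, l⟩ := q
    by_cases hkl : k = l
    · refine ⟨z, hz, fun i j hij hne => hS i j ?_ hne⟩
      grind
    obtain ⟨s, t, hs, ht, hst⟩ := exists_star_mul_mul_eq_zero hnontriv hpi (hz k) (hz l)
    refine ⟨fun m => z m * if m = k then s else if m = l then t else 1, fun j => ?_, ?_⟩
    · rw [← mul_assoc]
      split_ifs with h1 h2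
      · rwa [h1]
      · rwa [h2]
      · simpa using hz j
    · intro i j hij hne
      rcases Finset.mem_insert.1 hij with h | h
      · obtain ⟨rfl, rfl⟩ := Prod.mk.inj h
        simpa [Ne.symm hkl, mul_assoc] using hst
      · have key : ∀ x y : A, star (b i * (z i * x)) * (b j * (z j * y)) = 0 := fun x y => by
          rw [show star (b i * (z i * x)) * (b j * (z j * y)) =
            star x * (star (b i * z i) * (b j * z j)) * y by simp only [star_mul, mul_assoc],
            hS i j h hne, mul_zero, zero_mul]
        exact key _ _

/-- A norm one positive element `a` acts almost as the identity on a nonzero right ideal. -/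
lemma exists_ne_zero_norm_mul_sub_le {a : A} (hpos : ∃ x : A, a = star x * x) (hnorm : ‖a‖ = 1)
    {δ : ℝ} (hδ : 0 < δ) :
    ∃ b : A, b ≠ 0 ∧ ∀ z : A, ‖a * (b * z) - b * z‖ ≤ δ * ‖b * z‖ := by
  let _ : PartialOrder A := CStarAlgebra.spectralOrder A
  have : StarOrderedRing A := CStarAlgebra.spectralOrderedRing A
  have : Nontrivial A := ⟨a, 0, by rintro rfl; simp at hnorm⟩
  have ha : 0 ≤ a := by obtain ⟨x, rfl⟩ := hpos; exact star_mul_self_nonneg x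
  have hsa : IsSelfAdjoint a := ha.isSelfAdjoint
  have h1 : (1 : ℝ) ∈ spectrum ℝ a := hnorm ▸ CStarAlgebra.norm_mem_spectrum_of_nonneg ha
  have hle : ∀ t ∈ spectrum ℝ a, t ≤ 1 := fun t ht =>
    (le_abs_self t).trans (hnorm ▸ spectrum.norm_le_norm_of_mem ht)
  refine ⟨cfc (fun t : ℝ => max 0 (t - (1 - δ))) a, fun h => ?_, fun z => ?_⟩
  · have h2 := cfc_map_spectrum (R := ℝ) (fun t : ℝ => max 0 (t - (1 - δ))) a
    rw [h, spectrum.zero_eq] at h2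
    have h3 : max 0 ((1 : ℝ) - (1 - δ)) ∈ ({0} : Set ℝ) := h2 ▸ ⟨1, h1, rfl⟩
    simp at h3
    linarith
  · have hmul : a * cfc (fun t : ℝ => max 0 (t - (1 - δ))) a -
          cfc (fun t : ℝ => max 0 (t - (1 - δ))) a =
            cfc (fun t : ℝ => max (t - 1) (-δ)) a * cfc (fun t : ℝ => max 0 (t - (1 - δ))) a := by
      nth_rewrite 1 [← cfc_id' ℝ a]
      rw [← cfc_mul .., ← cfc_sub .., ← cfc_mul ..]
      refine cfc_congr fun t _ => ?_
      rcases le_total (t - (1 - δ)) 0 with h | h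
      · simp [max_eq_left h]
      · rw [max_eq_right h, max_eq_left (by linarith)]; ring
    rw [← mul_assoc, ← sub_mul, hmul, mul_assoc]
    refine (norm_mul_le _ _).trans (mul_le_mul_of_nonneg_right ?_ (norm_nonneg _))
    refine norm_cfc_le hδ.le fun t ht => ?_
    rw [Real.norm_eq_abs, abs_le]
    exact ⟨le_max_right _ _, max_le (by linarith [hle t ht]) (by linarith)⟩

/-- In a purely infinite simple C*-algebra, mutually orthogonal nonzero projections can be found
in any finite family of nonzero right ideals. -/
lemma exists_orthogonal_projections {ι : Type*} [Finite ι]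
    (hnontriv : ∃ x : A, ∀ c : ℂ, x ≠ c • (1 : A))
    (hpi : ∀ x : A, x ≠ 0 → ∃ a b : A, a * x * b = 1) (b : ι → A) (hb : ∀ j, b j ≠ 0) :
    ∃ z : ι → A, (∀ j, b j * z j ≠ 0) ∧ (∀ j, IsStarProjection (b j * z j)) ∧
      ∀ i j, i ≠ j → b i * z i * (b j * z j) = 0 := by
  obtain ⟨z, hz, horth⟩ := exists_pairwise_star_mul_mul_eq_zero hnontriv hpi b hb
  have : Nontrivial A := by
    obtain ⟨x, hx⟩ := hnontriv
    exact ⟨x, 0, by simpa using hx 0⟩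
  choose s hs using fun j => exists_mul_isometry hpi (hz j)
  have heq : ∀ j, b j * (z j * s j * star (b j * z j * s j)) =
      (b j * z j * s j) * star (b j * z j * s j) := fun j => by simp only [mul_assoc]
  refine ⟨fun j => z j * s j * star (b j * z j * s j), fun j h => ?_, fun j => ?_, ?_⟩
  · rw [heq] at h
    have hu : b j * z j * s j = 0 := (CStarRing.mul_star_self_eq_zero_iff _).1 h
    simpa [hu] using hs j
  · rw [heq]
    refine ⟨?_, .mul_star_self _⟩
    rw [IsIdempotentElem, mul_assoc, ← mul_assoc (star _), hs, one_mul]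
  · intro i j hij
    simp only [heq]
    have h := horth i j hij
    calc b i * z i * s i * star (b i * z i * s i) * (b j * z j * s j * star (b j * z j * s j))
        = b i * z i * s i * star (s i) * (star (b i * z i) * (b j * z j)) *
            (s j * star (b j * z j * s j)) := by simp only [star_mul, mul_assoc]
      _ = 0 := by rw [h, mul_zero, zero_mul]

end PurelyInfinite

/-- Let `A` be a unital purely infinite simple C*-algebra (Cuntz
characterization), and let `a₁, …, a_n ∈ A` be positive of norm one.  For every `ε > 0`
there are nonzero mutually orthogonal projections `p₁, …, p_n` with `‖p_j·a_j − p_j‖ < ε`. -/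
theorem stmt_4 {A : Type*} [NormedRing A] [StarRing A] [CStarRing A] [CompleteSpace A]
    [NormedAlgebra ℂ A] [StarModule ℂ A]
    (hnontriv : ∃ x : A, ∀ c : ℂ, x ≠ c • (1 : A))
    (hpi : ∀ x : A, x ≠ 0 → ∃ a b : A, a * x * b = 1)
    (n : ℕ) (a : Fin n → A)
    (hpos : ∀ j, ∃ x : A, a j = star x * x) (hnorm : ∀ j, ‖a j‖ = 1)
    (ε : ℝ) (hε : 0 < ε) :
    ∃ p : Fin n → A, (∀ j, p j ≠ 0) ∧
      (∀ j, IsSelfAdjoint (p j) ∧ p j * p j = p j) ∧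
      (∀ j k, j ≠ k → p j * p k = 0) ∧
      (∀ j, ‖p j * a j - p j‖ < ε) := by
  let _ : CStarAlgebra A := {}
  choose b hb hbz using fun j =>
    exists_ne_zero_norm_mul_sub_le (hpos j) (hnorm j) (half_pos hε)
  obtain ⟨z, hz, hproj, horth⟩ := exists_orthogonal_projections hnontriv hpi b hb
  refine ⟨fun j => b j * z j, hz, fun j => ⟨(hproj j).2, (hproj j).1⟩, horth, fun j => ?_⟩
  have ha : star (a j) = a j := by
    obtain ⟨x, hx⟩ := hpos j
    rw [hx, star_mul, star_star]
  have hp : ‖b j * z j‖ ≤ 1 := (hproj j).norm_le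
  calc ‖b j * z j * a j - b j * z j‖ = ‖a j * (b j * z j) - b j * z j‖ := by
        rw [← norm_star, star_sub, star_mul _ (a j), ha, (hproj j).2.star_eq]
    _ ≤ ε / 2 * ‖b j * z j‖ := hbz j (z j)
    _ < ε := by nlinarith
end

section
/- Let A be a unital purely infinite simple C*-algebra, let α, β > 0 be real numbers, and let F ⊆ A be a finite set of positive elements with α·1 ≤ a ≤ β·1 for all a ∈ F. Then for every ρ > 0 there exists δ > 0 such that the following holds: for every n ≥ 1, all positive elements c₁, …, c_n ∈ A with ‖c_j‖ = 1, and all functions λ₁, …, λ_n : F → [α, β], if ‖c_j·a·c_j − λ_j(a)·c_j²‖ < δ for all 1 ≤ j ≤ n and all a ∈ F, then there exist nonzero mutually orthogonal projections p₁, …, p_n ∈ A such that ‖p_j·a·p_k − δ_{jk}·λ_j(a)·p_j‖ < ρ for all 1 ≤ j, k ≤ n and all a ∈ F, where δ_{jk} is the Kronecker delta. -/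
section PurelyInfinite

variable {A : Type*} [CStarAlgebra A]

/-- A left invertible element can be rescaled on the right to an isometry. -/
lemma exists_isometry_of_mul_eq_one {a w : A} (h : a * w = 1) :
    ∃ r : A, star (w * r) * (w * r) = 1 := by
  let _ := CStarAlgebra.spectralOrder A
  have := CStarAlgebra.spectralOrderedRing A
  rcases subsingleton_or_nontrivial A with _ | _
  · exact ⟨0, Subsingleton.elim _ _⟩
  have ha : a ≠ 0 := by rintro rfl; simp at h
  have hpos : 0 ≤ star w * w := star_mul_self_nonneg w
  have hle : (1 : A) ≤ algebraMap ℝ A (‖a‖ ^ 2) * (star w * w) := by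
    have h1 : star w * (star a * a) * w ≤ star w * algebraMap ℝ A (‖a‖ ^ 2) * w := by
      refine star_left_conjugate_le_conjugate ?_ w
      exact CStarAlgebra.star_mul_le_algebraMap_norm_sq
    have h2 : star w * (star a * a) * w = 1 := by
      calc _ = star (a * w) * (a * w) := by simp [mul_assoc]
        _ = 1 := by simp [h]
    rw [h2, ← Algebra.commutes, mul_assoc] at h1
    exact h1
  have hunit : IsUnit (star w * w) := by
    have := CStarAlgebra.isUnit_of_le (1 : A) hle (by simp)
    exact ((show Commute _ _ from Algebra.commutes (‖a‖ ^ 2) (star w * w)).isUnit_mul_iff.1 this).2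
  refine ⟨(star w * w) ^ (-(1 / 2) : ℝ), ?_⟩
  have hs : star ((star w * w) ^ (-(1 / 2) : ℝ)) = (star w * w) ^ (-(1 / 2) : ℝ) :=
    (CFC.rpow_nonneg (a := star w * w)).isSelfAdjoint
  have hsplit := CFC.rpow_add (a := star w * w) (x := -(1 / 2)) (y := 1) hunit
  have hsplit' := CFC.rpow_add (a := star w * w) (x := -(1 / 2) + 1) (y := -(1 / 2)) hunit
  rw [star_mul, hs, mul_assoc, ← mul_assoc (star w), ← mul_assoc]
  rw [CFC.rpow_one _ hpos] at hsplit
  rw [← hsplit, ← hsplit']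
  norm_num
  exact CFC.rpow_zero _ hpos

/-- The continuous functional calculus does not vanish when the function is nonzero at a point of
the spectrum. -/
lemma cfc_ne_zero_of_mem_spectrum {h : A} (hh : IsSelfAdjoint h) {f : ℝ → ℝ} (hf : Continuous f)
    {t : ℝ} (ht : t ∈ spectrum ℝ h) (hft : f t ≠ 0) : cfc f h ≠ 0 := by
  intro h0
  rcases subsingleton_or_nontrivial A with _ | _
  · simp [spectrum.of_subsingleton] at ht
  have hmem : f t ∈ spectrum ℝ (cfc f h) := by
    rw [cfc_map_spectrum f h hh hf.continuousOn]
    exact ⟨t, ht, rfl⟩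
  rw [h0, spectrum.zero_eq] at hmem
  exact hft hmem

/-- A C⋆-algebra larger than the scalars contains two nonzero self-adjoint elements with product
zero. -/
lemma exists_isSelfAdjoint_mul_eq_zero (hA : ∃ x : A, ∀ c : ℂ, x ≠ c • (1 : A)) :
    ∃ e f : A, e ≠ 0 ∧ f ≠ 0 ∧ IsSelfAdjoint e ∧ e * f = 0 := by
  obtain ⟨h, hh, hns⟩ : ∃ h : A, IsSelfAdjoint h ∧ ∀ r : ℝ, h ≠ algebraMap ℝ A r := by
    by_contra! hcon
    obtain ⟨x, hx⟩ := hA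
    obtain ⟨r, hr⟩ := hcon (realPart x : A) (realPart x).2
    obtain ⟨s, hs⟩ := hcon (imaginaryPart x : A) (imaginaryPart x).2
    apply hx ((r : ℂ) + Complex.I * s)
    conv_lhs => rw [← realPart_add_I_smul_imaginaryPart x, hr, hs]
    simp [Algebra.algebraMap_eq_smul_one, add_smul, mul_smul]
  have : Nontrivial A := by
    by_contra hA'
    rw [not_nontrivial_iff_subsingleton] at hA'
    exact hns 0 (Subsingleton.elim _ _)
  obtain ⟨s, hs⟩ := ContinuousFunctionalCalculus.spectrum_nonempty (R := ℝ) h hh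
  obtain ⟨t, ht, hts⟩ : ∃ t ∈ spectrum ℝ h, t ≠ s := by
    by_contra! hcon
    exact hns s (CFC.eq_algebraMap_of_spectrum_subset_singleton h s hcon hh)
  have hd : 0 < (t - s) ^ 2 := by
    have := sub_ne_zero.2 hts
    positivity
  refine ⟨cfc (fun x : ℝ => max ((x - (s + t) / 2) * (t - s)) 0) h,
    cfc (fun x : ℝ => max (-((x - (s + t) / 2) * (t - s))) 0) h,
    cfc_ne_zero_of_mem_spectrum hh (by fun_prop) ht ?_,
    cfc_ne_zero_of_mem_spectrum hh (by fun_prop) hs ?_, cfc_predicate _ _, ?_⟩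
  · exact (lt_max_of_lt_left (by nlinarith)).ne'
  · exact (lt_max_of_lt_left (by nlinarith)).ne'
  · rw [← cfc_mul _ _ h (by fun_prop) (by fun_prop)]
    convert cfc_const_zero ℝ h using 2
    funext x
    rcases le_total ((x - (s + t) / 2) * (t - s)) 0 with hx | hx
    · rw [max_eq_right hx, zero_mul]
    · rw [max_eq_right (neg_nonpos.2 hx), mul_zero]

lemma norm_eq_one_of_isometry [Nontrivial A] {u : A} (hu : star u * u = 1) : ‖u‖ = 1 := by
  have := CStarRing.norm_star_mul_self (x := u)
  rw [hu, CStarRing.norm_one] at this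
  nlinarith [norm_nonneg u]

lemma isometry_mul {u v : A} (hu : star u * u = 1) (hv : star v * v = 1) :
    star (u * v) * (u * v) = 1 := by
  rw [star_mul, mul_assoc, ← mul_assoc (star u), hu, one_mul, hv]

lemma exists_isometry_of_ne_zero
    (hpi : ∀ x : A, x ≠ 0 → ∃ a b : A, a * x * b = 1)
    {w : A} (hw : w ≠ 0) :
    ∃ r : A, star (w * r) * (w * r) = 1 := by
  obtain ⟨a, b, h⟩ := hpi w hw
  obtain ⟨r, hr⟩ := exists_isometry_of_mul_eq_one (a := a) (w := w * b) (by rw [← mul_assoc, h])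
  exact ⟨b * r, by rwa [← mul_assoc w]⟩

lemma exists_orthogonal_isometries
    (hpi : ∀ x : A, x ≠ 0 → ∃ a b : A, a * x * b = 1)
    (hA : ∃ x : A, ∀ c : ℂ, x ≠ c • (1 : A)) :
    ∃ s t : A, star s * s = 1 ∧ star t * t = 1 ∧ star s * t = 0 := by
  obtain ⟨e, f, he, hf, hsa, hef⟩ := exists_isSelfAdjoint_mul_eq_zero hA
  obtain ⟨r, hr⟩ := exists_isometry_of_ne_zero hpi he
  obtain ⟨q, hq⟩ := exists_isometry_of_ne_zero hpi hf
  refine ⟨e * r, f * q, hr, hq, ?_⟩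
  rw [star_mul, hsa.star_eq, mul_assoc, ← mul_assoc e, hef, zero_mul, mul_zero]

lemma exists_isometries_star_mul_mul_eq_zero
    (hpi : ∀ x : A, x ≠ 0 → ∃ a b : A, a * x * b = 1)
    (hA : ∃ x : A, ∀ c : ℂ, x ≠ c • (1 : A)) (x : A) :
    ∃ s t : A, star s * s = 1 ∧ star t * t = 1 ∧ star s * x * t = 0 := by
  by_cases hx : x = 0
  · exact ⟨1, 1, by simp, by simp, by simp [hx]⟩
  obtain ⟨y, hy⟩ := exists_isometry_of_ne_zero hpi hx
  obtain ⟨s, t, hs, ht, hst⟩ := exists_orthogonal_isometries hpi hA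
  have hyt : y * t ≠ 0 := by
    intro h0
    have h1 : star t * t = 0 := by
      rw [← one_mul t, ← hy]
      simp only [mul_assoc, h0, mul_zero]
    apply hx
    rw [← mul_one x, ← ht, h1, mul_zero]
  obtain ⟨r, hr⟩ := exists_isometry_of_ne_zero hpi hyt
  refine ⟨x * y * s, y * t * r, isometry_mul hy hs, hr, ?_⟩
  calc star (x * y * s) * x * (y * t * r)
      = star s * (star (x * y) * (x * y)) * t * r := by simp only [star_mul, mul_assoc]
    _ = 0 := by rw [hy, mul_one, hst, zero_mul]

/-- Finitely many off-diagonal entries `star (u j) * g * u k` can be made to vanish simultaneously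
by multiplying the `u j` on the right by isometries. -/
lemma exists_isometries_off_diagonal_eq_zero
    (hpi : ∀ x : A, x ≠ 0 → ∃ a b : A, a * x * b = 1)
    (hA : ∃ x : A, ∀ c : ℂ, x ≠ c • (1 : A))
    {ι : Type*} [DecidableEq ι] (u : ι → A) (S : Finset (ι × ι × A))
    (hS : ∀ z ∈ S, z.1 ≠ z.2.1) :
    ∃ t : ι → A, (∀ j, star (t j) * t j = 1) ∧
      ∀ z ∈ S, star (u z.1 * t z.1) * z.2.2 * (u z.2.1 * t z.2.1) = 0 := by
  classical
  induction S using Finset.induction_on with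
  | empty => exact ⟨fun _ => 1, by simp, by simp⟩
  | insert z S hz ih =>
    obtain ⟨t, ht, h0⟩ := ih fun w hw => hS w (Finset.mem_insert_of_mem hw)
    obtain ⟨j, k, g⟩ := z
    have hjk : j ≠ k := hS _ (Finset.mem_insert_self _ _)
    obtain ⟨a, b, ha, hb, hab⟩ := exists_isometries_star_mul_mul_eq_zero hpi hA
      (star (u j * t j) * g * (u k * t k))
    refine ⟨fun i => t i * (if i = j then a else if i = k then b else 1), fun i => ?_, ?_⟩
    · refine isometry_mul (ht i) ?_
      split_ifs <;> simp [ha, hb]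
    · have key : ∀ (i l : ι) (g c d : A), star (u i * (t i * c)) * g * (u l * (t l * d)) =
          star c * (star (u i * t i) * g * (u l * t l)) * d := by
        intro i l g c d
        simp only [star_mul, mul_assoc]
      intro w hw
      simp only [key]
      rcases Finset.mem_insert.1 hw with rfl | hw
      · simpa [hjk.symm] using hab
      · rw [h0 w hw, mul_zero, zero_mul]

/-- Cutting down near the top of the spectrum of a positive contraction of norm one. -/
lemma exists_ne_zero_norm_sub_mul_le [Nontrivial A] {c : A} (hc : ∃ x : A, c = star x * x)
    (hc1 : ‖c‖ = 1) {ε : ℝ} (hε : 0 < ε) :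
    ∃ b k : A, b ≠ 0 ∧ ‖k‖ ≤ ε ∧ (1 - c) * b = k * b := by
  let _ := CStarAlgebra.spectralOrder A
  have := CStarAlgebra.spectralOrderedRing A
  obtain ⟨x, rfl⟩ := hc
  have hpos : 0 ≤ star x * x := star_mul_self_nonneg x
  set c := star x * x with hcdef
  have hsa : IsSelfAdjoint c := hpos.isSelfAdjoint
  have hle : ∀ t ∈ spectrum ℝ c, t ≤ 1 := fun t ht =>
    (Real.le_norm_self t).trans (hc1 ▸ spectrum.norm_le_norm_of_mem ht)
  have h1 : (1 : ℝ) ∈ spectrum ℝ c := hc1 ▸ CStarAlgebra.norm_mem_spectrum_of_nonneg hpos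
  refine ⟨cfc (fun t : ℝ => max (t - (1 - ε)) 0) c, cfc (fun t : ℝ => min (1 - t) ε) c,
    cfc_ne_zero_of_mem_spectrum hsa (by fun_prop) h1 ?_, norm_cfc_le hε.le fun t ht => ?_, ?_⟩
  · exact (lt_max_of_lt_left (by linarith)).ne'
  · have := hle t ht
    rw [Real.norm_of_nonneg (le_min (by linarith) hε.le)]
    exact min_le_right _ _
  · have h2 : 1 - c = cfc (fun t : ℝ => 1 - t) c := by
      rw [cfc_sub (fun _ => 1) (fun t => t) c, cfc_const_one ℝ c, cfc_id' ℝ c]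
    rw [h2, ← cfc_mul _ _ c (by fun_prop) (by fun_prop),
      ← cfc_mul _ _ c (by fun_prop) (by fun_prop)]
    congr 1
    funext t
    rcases le_total (t - (1 - ε)) 0 with ht | ht
    · rw [max_eq_right ht, mul_zero, mul_zero]
    · rw [min_eq_left (by linarith)]

lemma exists_isometry_norm_sub_mul_le [Nontrivial A]
    (hpi : ∀ x : A, x ≠ 0 → ∃ a b : A, a * x * b = 1)
    {c : A} (hc : ∃ x : A, c = star x * x)
    (hc1 : ‖c‖ = 1) {ε : ℝ} (hε : 0 < ε) :
    ∃ u : A, star u * u = 1 ∧ ‖u - c * u‖ ≤ ε := by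
  obtain ⟨b, k, hb, hk, hbk⟩ := exists_ne_zero_norm_sub_mul_le hc hc1 hε
  obtain ⟨r, hr⟩ := exists_isometry_of_ne_zero hpi hb
  refine ⟨b * r, hr, ?_⟩
  have h : b * r - c * (b * r) = k * (b * r) := by
    rw [← one_sub_mul, ← mul_assoc, hbk, mul_assoc]
  rw [h]
  calc ‖k * (b * r)‖ ≤ ‖k‖ * ‖b * r‖ := norm_mul_le _ _
    _ ≤ ε := by rwa [norm_eq_one_of_isometry hr, mul_one]

/-- Compressing `m` by an isometry `u` almost fixed by `c` is controlled by `c * m * c`. -/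
lemma norm_star_mul_mul_le [Nontrivial A] {c u m : A} {ε M : ℝ} (hc : IsSelfAdjoint c)
    (hc1 : ‖c‖ = 1) (hu : star u * u = 1) (hε : ‖u - c * u‖ ≤ ε) (hM : ‖m‖ ≤ M) :
    ‖star u * m * u‖ ≤ ‖c * m * c‖ + 2 * (M * ε) := by
  have hu1 : ‖u‖ = 1 := norm_eq_one_of_isometry hu
  have hM0 : 0 ≤ M := (norm_nonneg m).trans hM
  have hsplit : star u * m * u = star u * (c * m * c) * u +
      (star (u - c * u) * m * u + star u * c * m * (u - c * u)) := by
    simp only [star_sub, star_mul, hc.star_eq]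
    noncomm_ring
  have h1 : ‖star u * (c * m * c) * u‖ ≤ ‖c * m * c‖ := by
    calc _ ≤ ‖star u‖ * ‖c * m * c‖ * ‖u‖ := norm_mul₃_le
      _ = _ := by rw [norm_star, hu1, one_mul, mul_one]
  have h2 : ‖star (u - c * u) * m * u‖ ≤ M * ε := by
    calc _ ≤ ‖star (u - c * u)‖ * ‖m‖ * ‖u‖ := norm_mul₃_le
      _ = ‖m‖ * ‖u - c * u‖ := by rw [norm_star, hu1, mul_one, mul_comm]
      _ ≤ M * ε := by gcongr
  have h3 : ‖star u * c * m * (u - c * u)‖ ≤ M * ε := by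
    calc _ ≤ ‖star u * c‖ * ‖m‖ * ‖u - c * u‖ := norm_mul₃_le
      _ ≤ (‖star u‖ * ‖c‖) * ‖m‖ * ‖u - c * u‖ := by gcongr; exact norm_mul_le _ _
      _ = ‖m‖ * ‖u - c * u‖ := by rw [norm_star, hu1, hc1, one_mul, one_mul]
      _ ≤ M * ε := by gcongr
  rw [hsplit]
  linarith [norm_add_le (star u * (c * m * c) * u)
    (star (u - c * u) * m * u + star u * c * m * (u - c * u)),
    norm_add_le (star (u - c * u) * m * u) (star u * c * m * (u - c * u))]

end PurelyInfinite

/-- Let `A` be a unital purely infinite simple C*-algebra, `α, β > 0`,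
and `F ⊆ A` a finite set of positive elements with `α·1 ≤ a ≤ β·1` for `a ∈ F`.  For every
`ρ > 0` there is `δ > 0` such that whenever `c₁, …, c_n` are positive of norm one and
`λ_j : F → [α, β]` satisfy `‖c_j·a·c_j − λ_j(a)·c_j²‖ < δ`, there are nonzero mutually
orthogonal projections `p₁, …, p_n` with `‖p_j·a·p_k − δ_{jk}·λ_j(a)·p_j‖ < ρ`. -/
theorem stmt_5 {A : Type*} [NormedRing A] [StarRing A] [CStarRing A] [CompleteSpace A]
    [NormedAlgebra ℂ A] [StarModule ℂ A]
    (hnontriv : ∃ x : A, ∀ c : ℂ, x ≠ c • (1 : A))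
    (hpi : ∀ x : A, x ≠ 0 → ∃ a b : A, a * x * b = 1)
    (α β : ℝ) (hα : 0 < α) (hβ : 0 < β)
    (F : Finset A)
    (hF : ∀ a ∈ F, (∃ x : A, a = star x * x) ∧
      (∃ x : A, a - (α : ℂ) • (1 : A) = star x * x) ∧
      (∃ x : A, (β : ℂ) • (1 : A) - a = star x * x))
    (ρ : ℝ) (hρ : 0 < ρ) :
    ∃ δ : ℝ, 0 < δ ∧
      ∀ (n : ℕ), 1 ≤ n →
        ∀ (c : Fin n → A), (∀ j, ∃ x : A, c j = star x * x) → (∀ j, ‖c j‖ = 1) →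
          ∀ (lam : Fin n → A → ℝ), (∀ j, ∀ a ∈ F, lam j a ∈ Set.Icc α β) →
            (∀ j, ∀ a ∈ F, ‖c j * a * c j - ((lam j a : ℂ)) • (c j * c j)‖ < δ) →
            ∃ p : Fin n → A, (∀ j, p j ≠ 0) ∧
              (∀ j, IsSelfAdjoint (p j) ∧ p j * p j = p j) ∧
              (∀ j k, j ≠ k → p j * p k = 0) ∧
              (∀ j k, ∀ a ∈ F,
                ‖p j * a * p k - (if j = k then ((lam j a : ℂ)) else 0) • p j‖ < ρ) := by
  classical
  let _ : CStarAlgebra A := { }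
  have hnt : Nontrivial A := by
    by_contra hA
    rw [not_nontrivial_iff_subsingleton] at hA
    obtain ⟨x, hx⟩ := hnontriv
    exact hx 0 (Subsingleton.elim _ _)
  set M : ℝ := ∑ a ∈ F, ‖a‖ + β with hMdef
  have hM : 0 < M := by positivity
  have hFM : ∀ a ∈ F, ‖a‖ + β ≤ M := fun a ha => by
    have := Finset.single_le_sum (f := fun a : A => ‖a‖) (fun _ _ => norm_nonneg _) ha
    simp only [hMdef]
    linarith
  refine ⟨ρ / 2, by positivity, fun n _ c hc hc1 lam hlam hclose => ?_⟩
  have hε : 0 < ρ / (4 * M) := by positivity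
  choose v hv hvc using fun j => exists_isometry_norm_sub_mul_le hpi (hc j) (hc1 j) hε
  obtain ⟨t, ht, hvt⟩ := exists_isometries_off_diagonal_eq_zero hpi hnontriv v
    (((Finset.univ ×ˢ Finset.univ ×ˢ insert 1 F) : Finset (Fin n × Fin n × A)).filter
      fun z => z.1 ≠ z.2.1) (fun z hz => (Finset.mem_filter.1 hz).2)
  set u : Fin n → A := fun j => v j * t j with hudef
  have hu : ∀ j, star (u j) * u j = 1 := fun j => isometry_mul (hv j) (ht j)
  have hu1 : ∀ j, ‖u j‖ = 1 := fun j => norm_eq_one_of_isometry (hu j)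
  have hoff : ∀ j k, j ≠ k → ∀ g ∈ insert 1 F, star (u j) * g * u k = 0 := fun j k hjk g hg =>
    hvt (j, k, g) (by simpa [hjk] using hg)
  have hdiag : ∀ j, ∀ a ∈ F, ‖star (u j) * (a - (lam j a : ℂ) • 1) * u j‖ < ρ := by
    intro j a ha
    have huc : ‖u j - c j * u j‖ ≤ ρ / (4 * M) := by
      have h : u j - c j * u j = (v j - c j * v j) * t j := by
        simp only [hudef, sub_mul, mul_assoc]
      rw [h]
      refine (norm_mul_le _ _).trans ?_
      rw [norm_eq_one_of_isometry (ht j), mul_one]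
      exact hvc j
    have hm : ‖a - (lam j a : ℂ) • (1 : A)‖ ≤ M := by
      refine (norm_sub_le _ _).trans (le_trans ?_ (hFM a ha))
      obtain ⟨hl, hr⟩ := hlam j a ha
      rw [norm_smul, CStarRing.norm_one, mul_one, Complex.norm_real,
        Real.norm_of_nonneg (hα.le.trans hl)]
      gcongr
    have hcm : c j * (a - (lam j a : ℂ) • 1) * c j =
        c j * a * c j - (lam j a : ℂ) • (c j * c j) := by
      simp [mul_sub, sub_mul]
    have hcsa : IsSelfAdjoint (c j) := by
      obtain ⟨x, hx⟩ := hc j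
      rw [hx]
      exact .star_mul_self x
    have h := norm_star_mul_mul_le hcsa (hc1 j) (hu j) huc hm
    rw [hcm] at h
    have h4 : M * (ρ / (4 * M)) = ρ / 4 := by field_simp
    linarith [hclose j a ha]
  refine ⟨fun j => u j * star (u j), fun j h0 => ?_, fun j => ⟨.mul_star_self _, ?_⟩,
    fun j k hjk => ?_, fun j k a ha => ?_⟩
  · apply one_ne_zero (α := A)
    calc (1 : A) = star (u j) * u j * (star (u j) * u j) := by rw [hu, mul_one]
      _ = star (u j) * (u j * star (u j)) * u j := by simp only [mul_assoc]
      _ = 0 := by rw [show u j * star (u j) = 0 from h0, mul_zero, zero_mul]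
  · rw [mul_assoc, ← mul_assoc (star (u j)), hu, one_mul]
  · have h := hoff j k hjk 1 (Finset.mem_insert_self _ _)
    rw [mul_one] at h
    rw [mul_assoc, ← mul_assoc (star (u j)), h, zero_mul, mul_zero]
  · have hconj : u j * star (u j) * a * (u k * star (u k)) =
        u j * (star (u j) * a * u k) * star (u k) := by simp only [mul_assoc]
    rcases eq_or_ne j k with rfl | hjk
    · have h : u j * star (u j) * a * (u j * star (u j)) - (lam j a : ℂ) • (u j * star (u j)) =
          u j * (star (u j) * (a - (lam j a : ℂ) • 1) * u j) * star (u j) := by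
        rw [hconj, mul_sub, sub_mul, mul_smul_comm, mul_one, smul_mul_assoc, hu, mul_sub, sub_mul,
          mul_smul_comm, mul_one, smul_mul_assoc]
      rw [if_pos rfl, h]
      refine lt_of_le_of_lt norm_mul₃_le ?_
      rw [norm_star, hu1, one_mul, mul_one]
      exact hdiag j a ha
    · rw [if_neg hjk, hconj, hoff j k hjk a (Finset.mem_insert_of_mem ha)]
      simpa using hρ
end

section
/- Let A be a unital purely infinite simple C*-algebra, and let ω be a state on A. Then for every ε > 0 and every finite subset F ⊆ A there exists a nonzero projection p ∈ A such that ‖p·a·p − ω(a)·p‖ < ε for all a ∈ F. -/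
namespace CStarAlgebra

open scoped ComplexStarModule

variable {A : Type*} [CStarAlgebra A]

lemma exists_isSelfAdjoint_mul_star_mul_self_mul_eq_one {z : A} {c : ℝ} (hc : 0 < c)
    (hz : ∀ t ∈ spectrum ℝ (star z * z), c ≤ t) :
    ∃ d : A, IsSelfAdjoint d ∧ d * (star z * z) * d = 1 ∧ ‖d‖ ≤ (√c)⁻¹ := by
  have hsa : IsSelfAdjoint (star z * z) := .star_mul_self z
  have hne : ∀ t ∈ spectrum ℝ (star z * z), √t ≠ 0 := fun t ht =>
    (Real.sqrt_pos.2 (hc.trans_le (hz t ht))).ne'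
  have hcont : ContinuousOn (fun t : ℝ => (√t)⁻¹) (spectrum ℝ (star z * z)) :=
    Real.continuous_sqrt.continuousOn.inv₀ hne
  have hcont' : ContinuousOn (fun t : ℝ => (√t)⁻¹ * t) (spectrum ℝ (star z * z)) :=
    hcont.mul (continuousOn_id' _)
  refine ⟨cfc (fun t : ℝ => (√t)⁻¹) (star z * z), IsSelfAdjoint.cfc, ?_, ?_⟩
  · calc _ = cfc (fun t : ℝ => (√t)⁻¹) (star z * z) * cfc (fun t : ℝ => t) (star z * z) *
          cfc (fun t : ℝ => (√t)⁻¹) (star z * z) := by rw [cfc_id' ℝ (star z * z)]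
      _ = cfc (fun t : ℝ => (√t)⁻¹ * t * (√t)⁻¹) (star z * z) := by
        rw [← cfc_mul _ _ _ hcont (continuousOn_id' _),
          ← cfc_mul _ _ _ hcont' hcont]
      _ = cfc (fun _ : ℝ => (1 : ℝ)) (star z * z) := by
        refine cfc_congr fun t ht => ?_
        have h0 := hne t ht
        have := Real.mul_self_sqrt (hc.le.trans (hz t ht))
        field_simp
        nlinarith
      _ = 1 := cfc_const_one ℝ _
  · refine norm_cfc_le (by positivity) fun t ht => ?_
    rw [Real.norm_of_nonneg (by positivity)]
    exact inv_anti₀ (Real.sqrt_pos.2 hc) (Real.sqrt_le_sqrt (hz t ht))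

lemma exists_isometry_mul (hpi : ∀ x : A, x ≠ 0 → ∃ a b : A, a * x * b = 1) [Nontrivial A]
    {x : A} (hx : x ≠ 0) : ∃ c : A, star (x * c) * (x * c) = 1 := by
  obtain ⟨a, b, hab⟩ := hpi x hx
  let _ := spectralOrder A
  have := spectralOrderedRing A
  have ha : a ≠ 0 := by rintro rfl; simp at hab
  have hn : 0 < ‖star a * a‖ := norm_pos_iff.2 (by simpa using ha)
  have hle : (1 : A) ≤ ‖star a * a‖ • (star (x * b) * (x * b)) := by
    have h := star_left_conjugate_le_norm_smul (a := x * b) (b := star a * a)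
    have he : star (x * b) * (star a * a) * (x * b) = 1 := by
      calc _ = star (a * x * b) * (a * x * b) := by simp only [star_mul, mul_assoc]
        _ = 1 := by rw [hab]; simp
    rwa [he] at h
  have hle' : algebraMap ℝ A (‖star a * a‖)⁻¹ ≤ star (x * b) * (x * b) := by
    have h := smul_le_smul_of_nonneg_left hle (inv_nonneg.2 hn.le)
    rwa [smul_smul, inv_mul_cancel₀ hn.ne', one_smul, ← Algebra.algebraMap_eq_smul_one] at h
  obtain ⟨d, hd, hd1, -⟩ := exists_isSelfAdjoint_mul_star_mul_self_mul_eq_one (inv_pos.2 hn)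
    ((algebraMap_le_iff_le_spectrum (.star_mul_self _)).1 hle')
  refine ⟨b * d, ?_⟩
  rw [← hd1, ← mul_assoc x, star_mul, hd.star_eq]
  simp only [mul_assoc]

/-- The value at `a` of a tent function of radius `δ` centred at `μ`. -/
noncomputable def tent (a : A) (μ δ : ℝ) : A := cfc (fun t : ℝ => max 0 (δ - |t - μ|)) a

lemma tent_ne_zero {a : A} (ha : IsSelfAdjoint a) {μ δ : ℝ} (hμ : μ ∈ spectrum ℝ a)
    (hδ : 0 < δ) : tent a μ δ ≠ 0 := by
  intro h
  have := norm_apply_le_norm_cfc (fun t : ℝ => max 0 (δ - |t - μ|)) a hμ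
  rw [tent] at h
  simp [h, hδ.le] at this
  linarith

lemma star_tent (a : A) (μ δ : ℝ) : star (tent a μ δ) = tent a μ δ :=
  IsSelfAdjoint.cfc.star_eq

lemma tent_mul_tent (a : A) {μ ν δ : ℝ} (h : 2 * δ ≤ |μ - ν|) :
    tent a μ δ * tent a ν δ = 0 := by
  rw [tent, tent, ← cfc_mul _ _ _, ← cfc_const_zero ℝ a]
  refine cfc_congr fun t _ => ?_
  have := abs_sub_le μ t ν
  rw [abs_sub_comm μ t] at this
  rcases le_total δ |t - μ| with h1 | h1
  · simp [max_eq_left (sub_nonpos.2 h1)]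
  · simp [max_eq_left (sub_nonpos.2 (show δ ≤ |t - ν| by linarith))]

lemma exists_sub_mul_tent {a : A} (ha : IsSelfAdjoint a) (μ : ℝ) {δ : ℝ} (hδ : 0 ≤ δ) :
    ∃ k : A, ‖k‖ ≤ δ ∧ (a - algebraMap ℝ A μ) * tent a μ δ = k * tent a μ δ := by
  refine ⟨cfc (fun t : ℝ => max (-δ) (min δ (t - μ))) a, norm_cfc_le hδ fun t _ => ?_, ?_⟩
  · rw [Real.norm_eq_abs, abs_le]
    exact ⟨le_max_left _ _, max_le (by linarith) (min_le_left _ _)⟩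
  · have : a - algebraMap ℝ A μ = cfc (fun t : ℝ => t - μ) a := by
      rw [cfc_sub .., cfc_id' ℝ a, cfc_const μ a]
    rw [this, tent, ← cfc_mul .., ← cfc_mul ..]
    refine cfc_congr fun t _ => ?_
    rcases le_total δ |t - μ| with h1 | h1
    · simp [max_eq_left (sub_nonpos.2 h1)]
    · obtain ⟨h2, h3⟩ := abs_le.1 h1
      simp [min_eq_right h3, max_eq_right h2]

lemma norm_le_one_of_star_mul_self [Nontrivial A] {t : A} (ht : star t * t = 1) : ‖t‖ ≤ 1 := by
  have := CStarRing.norm_star_mul_self (x := t)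
  rw [ht, CStarRing.norm_one] at this
  nlinarith [norm_nonneg t]

lemma norm_star_mul_mul_le {s t : A} (hs : ‖s‖ ≤ 1) (ht : ‖t‖ ≤ 1) (x : A) :
    ‖star s * x * t‖ ≤ ‖x‖ := by
  calc _ ≤ ‖star s * x‖ * ‖t‖ := norm_mul_le _ _
    _ ≤ ‖star s‖ * ‖x‖ * ‖t‖ := by gcongr; exact norm_mul_le _ _
    _ ≤ 1 * ‖x‖ * 1 := by rw [norm_star]; gcongr
    _ = ‖x‖ := by ring

lemma exists_isometry_norm_sub_lt_of_mem_spectrum [Nontrivial A]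
    (hpi : ∀ x : A, x ≠ 0 → ∃ a b : A, a * x * b = 1) {a : A} (ha : IsSelfAdjoint a) {μ : ℝ}
    (hμ : μ ∈ spectrum ℝ a) {ε : ℝ} (hε : 0 < ε) :
    ∃ t : A, star t * t = 1 ∧ ‖star t * a * t - algebraMap ℝ A μ‖ < ε := by
  obtain ⟨k, hk, hak⟩ := exists_sub_mul_tent ha μ (half_pos hε).le
  obtain ⟨c, hc⟩ := exists_isometry_mul hpi (tent_ne_zero ha hμ (half_pos hε))
  set t := tent a μ (ε / 2) * c
  have ht := norm_le_one_of_star_mul_self hc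
  refine ⟨t, hc, ?_⟩
  have : star t * a * t - algebraMap ℝ A μ = star t * k * t := by
    calc _ = star t * ((a - algebraMap ℝ A μ) * t) := by
          rw [sub_mul, mul_sub, ← mul_assoc (star t) a, Algebra.algebraMap_eq_smul_one, smul_mul_assoc,
            one_mul, mul_smul_comm, hc]
      _ = star t * k * t := by rw [← mul_assoc (a - _), hak, mul_assoc k, mul_assoc (star t)]
  rw [this]
  linarith [norm_star_mul_mul_le ht ht k]

lemma norm_star_mul_mul_sub_smul_le [Nontrivial A] {t : A} (ht : star t * t = 1) (x : A) (μ : ℂ) :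
    ‖star t * x * t - μ • 1‖ ≤ ‖x - μ • 1‖ := by
  have h1 := norm_le_one_of_star_mul_self ht
  convert norm_star_mul_mul_le h1 h1 (x - μ • 1) using 2
  rw [mul_sub, sub_mul, mul_smul_comm, mul_one, smul_mul_assoc, ht]

lemma star_mul_self_mul {s t : A} (hs : star s * s = 1) (ht : star t * t = 1) :
    star (s * t) * (s * t) = 1 := by
  rw [star_mul, mul_assoc, ← mul_assoc (star s), hs, one_mul, ht]

lemma exists_isometry_norm_sub_smul_lt [Nontrivial A]
    (hpi : ∀ x : A, x ≠ 0 → ∃ a b : A, a * x * b = 1) (x : A) {ε : ℝ} (hε : 0 < ε) :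
    ∃ t : A, star t * t = 1 ∧ ∃ μ : ℂ, ‖star t * x * t - μ • 1‖ < ε := by
  have key : ∀ a : A, IsSelfAdjoint a → ∃ t : A, star t * t = 1 ∧
      ∃ μ : ℂ, ‖star t * a * t - μ • 1‖ < ε / 2 := fun a ha => by
    obtain ⟨μ, hμ⟩ := ContinuousFunctionalCalculus.spectrum_nonempty (R := ℝ) a ha
    obtain ⟨t, ht, h⟩ := exists_isometry_norm_sub_lt_of_mem_spectrum hpi ha hμ (half_pos hε)
    refine ⟨t, ht, μ, ?_⟩
    simpa [Algebra.algebraMap_eq_smul_one] using h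
  obtain ⟨s, hs, μ, hμ⟩ := key (ℜ x) (ℜ x).2
  obtain ⟨t, ht, ν, hν⟩ := key (star s * (ℑ x : A) * s) ((ℑ x).2.conjugate' s)
  refine ⟨s * t, star_mul_self_mul hs ht, μ + Complex.I * ν, ?_⟩
  have h1 := norm_star_mul_mul_sub_smul_le ht (star s * (ℜ x : A) * s) μ
  calc _ = ‖(star t * (star s * (ℜ x : A) * s) * t - μ • 1) +
        Complex.I • (star t * (star s * (ℑ x : A) * s) * t - ν • 1)‖ := by
        conv_lhs => rw [← realPart_add_I_smul_imaginaryPart x]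
        simp only [star_mul, mul_add, add_mul, mul_smul_comm, smul_mul_assoc, smul_sub, add_smul,
          mul_smul, mul_assoc]
        abel_nf
    _ ≤ _ := norm_add_le _ _
    _ < ε := by rw [norm_smul, Complex.norm_I, one_mul]; linarith

lemma exists_isometry_forall_norm_sub_smul_lt [Nontrivial A]
    (hpi : ∀ x : A, x ≠ 0 → ∃ a b : A, a * x * b = 1) {ι : Type*} [DecidableEq ι] (x : ι → A)
    (S : Finset ι) {ε : ℝ} (hε : 0 < ε) :
    ∃ t : A, star t * t = 1 ∧ ∃ μ : ι → ℂ, ∀ i ∈ S, ‖star t * x i * t - μ i • 1‖ < ε := by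
  induction S using Finset.induction_on with
  | empty => exact ⟨1, by simp, 0, by simp⟩
  | insert i S hi ih =>
    obtain ⟨s, hs, μ, hμ⟩ := ih
    obtain ⟨t, ht, ν, hν⟩ := exists_isometry_norm_sub_smul_lt hpi (star s * x i * s) hε
    have hst : ∀ j, star (s * t) * x j * (s * t) = star t * (star s * x j * s) * t := fun j => by
      simp only [star_mul, mul_assoc]
    refine ⟨s * t, star_mul_self_mul hs ht, Function.update μ i ν, fun j hj => ?_⟩
    rw [hst]
    obtain rfl | hji := eq_or_ne j i
    · simpa using hν
    · rw [Function.update_of_ne hji]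
      exact (norm_star_mul_mul_sub_smul_le ht _ _).trans_lt
        (hμ j ((Finset.mem_insert.1 hj).resolve_left hji))

lemma exists_isometry_pair_star_mul_eq_zero [Nontrivial A]
    (hpi : ∀ x : A, x ≠ 0 → ∃ a b : A, a * x * b = 1) (hsc : ∃ x : A, ∀ c : ℂ, x ≠ c • (1 : A)) :
    ∃ v w : A, star v * v = 1 ∧ star w * w = 1 ∧ star v * w = 0 := by
  obtain ⟨a, ha, hac⟩ : ∃ a : A, IsSelfAdjoint a ∧ ∀ r : ℝ, a ≠ algebraMap ℝ A r := by
    by_contra! h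
    obtain ⟨x, hx⟩ := hsc
    obtain ⟨r, hr⟩ := h (ℜ x) (ℜ x).2
    obtain ⟨s, hs⟩ := h (ℑ x) (ℑ x).2
    refine hx (r + Complex.I * s) ?_
    conv_lhs => rw [← realPart_add_I_smul_imaginaryPart x, hr, hs]
    simp [Algebra.algebraMap_eq_smul_one, add_smul, mul_smul]
  obtain ⟨μ, hμ⟩ := ContinuousFunctionalCalculus.spectrum_nonempty (R := ℝ) a ha
  obtain ⟨ν, hν, hne⟩ : ∃ ν ∈ spectrum ℝ a, ν ≠ μ := by
    by_contra! h
    refine hac μ ?_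
    conv_lhs => rw [← cfc_id' ℝ a]
    rw [← cfc_const μ a]
    exact cfc_congr fun t ht => h t ht
  have hδ : 0 < |μ - ν| / 2 := half_pos (abs_pos.2 (sub_ne_zero.2 hne.symm))
  obtain ⟨c, hc⟩ := exists_isometry_mul hpi (tent_ne_zero ha hμ hδ)
  obtain ⟨d, hd⟩ := exists_isometry_mul hpi (tent_ne_zero ha hν hδ)
  refine ⟨_, _, hc, hd, ?_⟩
  rw [star_mul, star_tent, mul_assoc, ← mul_assoc (tent a μ _),
    tent_mul_tent a (by linarith), zero_mul, mul_zero]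

/-- The tuples of scalars to which a tuple `a` in `A` can be compressed up to `ε`. -/
def approxCompressions {ι : Type*} [Fintype ι] (a : ι → A) (ε : ℝ) : Set (ι → ℂ) :=
  {μ | ∃ s : A, ‖fun i => star s * a i * s - μ i • (1 : A)‖ < ε}

lemma convex_approxCompressions [Nontrivial A]
    (hpi : ∀ x : A, x ≠ 0 → ∃ a b : A, a * x * b = 1) (hsc : ∃ x : A, ∀ c : ℂ, x ≠ c • (1 : A))
    {ι : Type*} [Fintype ι] (a : ι → A) (ε : ℝ) : Convex ℝ (approxCompressions a ε) := by
  classical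
  rintro μ ⟨s, hs⟩ ν ⟨t, ht⟩ α β hα hβ hαβ
  obtain ⟨v, w, hv, hw, hvw⟩ := exists_isometry_pair_star_mul_eq_zero hpi hsc
  have hwv : star w * v = 0 := by simpa using congrArg star hvw
  have hlt : α * ‖fun i => star s * a i * s - μ i • (1 : A)‖ +
      β * ‖fun i => star t * a i * t - ν i • (1 : A)‖ < ε := by
    rcases hα.eq_or_lt with rfl | hα'
    · obtain rfl : β = 1 := by linarith
      simpa using ht
    · linarith [mul_lt_mul_of_pos_left hs hα', mul_le_mul_of_nonneg_left ht.le hβ,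
        show α * ε + β * ε = ε by rw [← add_mul, hαβ, one_mul]]
  set P := ‖fun i => star s * a i * s - μ i • (1 : A)‖
  set Q := ‖fun i => star t * a i * t - ν i • (1 : A)‖
  set η := (ε - (α * P + β * Q)) / 4
  have hη : 0 < η := by simp only [η]; linarith
  obtain ⟨u, hu, ρ, hρ⟩ := exists_isometry_forall_norm_sub_smul_lt hpi
    (Sum.elim (fun i => star s * a i * t) (fun i => star t * a i * s)) Finset.univ hη
  have hv1 := norm_le_one_of_star_mul_self hv
  have hw1 := norm_le_one_of_star_mul_self hw
  have cross : ∀ {x v w : A} {ρ : ℂ}, ‖v‖ ≤ 1 → ‖w‖ ≤ 1 → star v * w = 0 →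
      ‖star u * x * u - ρ • 1‖ < η → ‖star (u * v) * x * (u * w)‖ ≤ η := by
    intro x v w ρ hv hw hvw h
    refine le_trans (le_of_eq ?_) ((norm_star_mul_mul_le hv hw _).trans h.le)
    congr 1
    rw [mul_sub, sub_mul, mul_smul_comm, mul_one, smul_mul_assoc, hvw, smul_zero, sub_zero]
    simp only [star_mul, mul_assoc]
  have hsq : √α * √β ≤ 1 := by
    nlinarith [Real.sqrt_nonneg α, Real.sqrt_nonneg β, Real.sq_sqrt hα, Real.sq_sqrt hβ,
      sq_nonneg (√α - √β)]
  have hsq0 : 0 ≤ √α * √β := by positivity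
  refine ⟨√α • (s * (u * v)) + √β • (t * (u * w)), ?_⟩
  have hP : 0 ≤ P := norm_nonneg _
  have hQ : 0 ≤ Q := norm_nonneg _
  refine lt_of_le_of_lt ((pi_norm_le_iff_of_nonneg (r := α * P + β * Q + 2 * η)
    (by positivity)).2 fun i => ?_) (by simp only [η]; linarith)
  have e : star (√α • (s * (u * v)) + √β • (t * (u * w))) * a i *
        (√α • (s * (u * v)) + √β • (t * (u * w))) - (α • μ + β • ν) i • (1 : A) =
      α • (star (u * v) * (star s * a i * s) * (u * v) - μ i • 1) +
      β • (star (u * w) * (star t * a i * t) * (u * w) - ν i • 1) +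
      (√α * √β) • (star (u * v) * (star s * a i * t) * (u * w)) +
      (√α * √β) • (star (u * w) * (star t * a i * s) * (u * v)) := by
    have h1 : α = √α * √α := (Real.mul_self_sqrt hα).symm
    have h2 : β = √β * √β := (Real.mul_self_sqrt hβ).symm
    have h3 : (α • μ + β • ν) i • (1 : A) = α • μ i • 1 + β • ν i • 1 := by
      rw [Pi.add_apply, add_smul, Pi.smul_apply, Pi.smul_apply, smul_assoc, smul_assoc]
    rw [h3]
    generalize √α = p at *
    generalize √β = q at *
    subst h1 h2
    simp only [star_add, star_smul, star_mul, star_trivial, add_mul, mul_add, smul_mul_assoc,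
      mul_smul_comm, smul_add, smul_sub, mul_assoc, mul_smul]
    simp only [smul_comm q p]
    abel
  simp only [e]
  have b1 : ‖star (u * v) * (star s * a i * s) * (u * v) - μ i • (1 : A)‖ ≤ P :=
    (norm_star_mul_mul_sub_smul_le (star_mul_self_mul hu hv) _ _).trans
      (norm_le_pi_norm (fun i => star s * a i * s - μ i • (1 : A)) i)
  have b2 : ‖star (u * w) * (star t * a i * t) * (u * w) - ν i • (1 : A)‖ ≤ Q :=
    (norm_star_mul_mul_sub_smul_le (star_mul_self_mul hu hw) _ _).trans
      (norm_le_pi_norm (fun i => star t * a i * t - ν i • (1 : A)) i)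
  have b3 := cross hv1 hw1 hvw (hρ (.inl i) (Finset.mem_univ _))
  have b4 := cross hw1 hv1 hwv (hρ (.inr i) (Finset.mem_univ _))
  refine norm_add₄_le.trans ?_
  rw [norm_smul, norm_smul, norm_smul, norm_smul, Real.norm_of_nonneg hα, Real.norm_of_nonneg hβ,
    Real.norm_of_nonneg hsq0]
  simp only [Sum.elim_inl, Sum.elim_inr] at b3 b4
  have c3 := mul_le_mul hsq b3 (norm_nonneg _) zero_le_one
  have c4 := mul_le_mul hsq b4 (norm_nonneg _) zero_le_one
  have c1 := mul_le_mul_of_nonneg_left b1 hα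
  have c2 := mul_le_mul_of_nonneg_left b2 hβ
  linarith

lemma exists_nonneg_sub_eq {ω : A →ₗ[ℂ] ℂ} (hω1 : ω 1 = 1)
    (hωpos : ∀ x : A, ∃ r : ℝ, 0 ≤ r ∧ ω (star x * x) = (r : ℂ)) {b : A} (hb : IsSelfAdjoint b)
    {m : ℝ} (hm : ∀ t ∈ spectrum ℝ b, t ≤ m) : ∃ r : ℝ, 0 ≤ r ∧ (m : ℂ) - ω b = r := by
  obtain ⟨r, hr, h⟩ := hωpos (cfc (fun t : ℝ => √(m - t)) b)
  refine ⟨r, hr, ?_⟩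
  have hsq : star (cfc (fun t : ℝ => √(m - t)) b) * cfc (fun t : ℝ => √(m - t)) b =
      algebraMap ℝ A m - b := by
    rw [IsSelfAdjoint.cfc.star_eq, ← cfc_mul ..]
    calc _ = cfc (fun t : ℝ => m - t) b :=
          cfc_congr fun t ht => Real.mul_self_sqrt (sub_nonneg.2 (hm t ht))
      _ = algebraMap ℝ A m - b := by rw [cfc_sub .., cfc_id' ℝ b, cfc_const m b]
  rw [← h, hsq, Algebra.algebraMap_eq_smul_one, map_sub, ← Complex.coe_smul, map_smul, hω1]
  simp

lemma re_apply_eq_re_apply_realPart {ω : A →ₗ[ℂ] ℂ} (hω1 : ω 1 = 1)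
    (hωpos : ∀ x : A, ∃ r : ℝ, 0 ≤ r ∧ ω (star x * x) = (r : ℂ)) (a : A) :
    (ω a).re = (ω (ℜ a : A)).re := by
  obtain ⟨m, hm⟩ := (spectrum.isCompact (𝕜 := ℝ) (ℑ a : A)).bddAbove
  obtain ⟨r, -, hr⟩ := exists_nonneg_sub_eq hω1 hωpos (ℑ a).2 fun t ht => hm ht
  have him := congrArg Complex.im hr
  simp only [Complex.sub_im, Complex.ofReal_im] at him
  conv_lhs => rw [← realPart_add_I_smul_imaginaryPart a]
  simp only [map_add, map_smul, Complex.add_re, smul_eq_mul, Complex.mul_re, Complex.I_re,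
    Complex.I_im]
  linarith

lemma realPart_star_mul_mul (w b : A) :
    (ℜ (star w * b * w) : A) = star w * (ℜ b : A) * w := by
  simp only [realPart_apply_coe, star_mul, star_star, mul_smul_comm, smul_mul_assoc, mul_add,
    add_mul, mul_assoc]

lemma closure_approxCompressions_subset [Nontrivial A] {ι : Type*} [Fintype ι] (a : ι → A)
    {ε δ : ℝ} (h : ε < δ) :
    closure (approxCompressions a ε) ⊆ approxCompressions a δ := by
  intro μ hμ
  obtain ⟨ν, ⟨s, hs⟩, hν⟩ := Metric.mem_closure_iff.1 hμ (δ - ε) (sub_pos.2 h)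
  refine ⟨s, ?_⟩
  have h1 : ‖fun i => (ν i - μ i) • (1 : A)‖ ≤ dist μ ν := by
    refine (pi_norm_le_iff_of_nonneg dist_nonneg).2 fun i => ?_
    rw [norm_smul, CStarRing.norm_one, mul_one, ← dist_eq_norm, dist_comm]
    exact dist_le_pi_dist μ ν i
  calc _ = ‖(fun i => star s * a i * s - ν i • (1 : A)) + fun i => (ν i - μ i) • (1 : A)‖ := by
        congr 1; ext i; simp [sub_smul]
    _ ≤ _ := norm_add_le _ _
    _ < δ := by linarith

lemma state_mem_approxCompressions [Nontrivial A]
    (hpi : ∀ x : A, x ≠ 0 → ∃ a b : A, a * x * b = 1) (hsc : ∃ x : A, ∀ c : ℂ, x ≠ c • (1 : A))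
    {ω : A →ₗ[ℂ] ℂ} (hω1 : ω 1 = 1)
    (hωpos : ∀ x : A, ∃ r : ℝ, 0 ≤ r ∧ ω (star x * x) = (r : ℂ))
    {ι : Type*} [Fintype ι] (a : ι → A) {ε : ℝ} (hε : 0 < ε) :
    (fun i => ω (a i)) ∈ approxCompressions a ε := by
  classical
  by_contra hmem
  obtain ⟨f, u, hfu, hu⟩ := RCLike.geometric_hahn_banach_closed_point (𝕜 := ℂ)
    (convex_approxCompressions hpi hsc a (ε / 2)).closure isClosed_closure
    fun h => hmem (closure_approxCompressions_subset a (half_lt_self hε) h)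
  set c : ι → ℂ := fun i => f fun j => if i = j then 1 else 0
  have hf : ∀ μ : ι → ℂ, f μ = ∑ i, c i * μ i := fun μ => by
    simpa [c, mul_comm] using (f : (ι → ℂ) →ₗ[ℂ] ℂ).pi_apply_eq_sum_univ μ
  set B : A := ∑ i, c i • a i
  have hfω : f (fun i => ω (a i)) = ω B := by simp [hf, B]
  obtain ⟨m, hm, hmax⟩ := (spectrum.isCompact (𝕜 := ℝ) (ℜ B : A)).exists_isMaxOn
    (ContinuousFunctionalCalculus.spectrum_nonempty (R := ℝ) (ℜ B : A) (ℜ B).2) continuousOn_id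
  obtain ⟨r, hr, hmr⟩ := exists_nonneg_sub_eq hω1 hωpos (ℜ B).2 fun t ht => hmax ht
  have hle : (ω B).re ≤ m := by
    rw [re_apply_eq_re_apply_realPart hω1 hωpos]
    have := congrArg Complex.re hmr
    simp only [Complex.sub_re, Complex.ofReal_re, id] at this
    linarith
  simp only [RCLike.re_to_complex] at hfu hu
  rw [hfω] at hu
  have hη : 0 < (ω B).re - u := sub_pos.2 hu
  set η := (ω B).re - u
  set C := 1 + ∑ i, ‖c i‖
  have hC : 0 < C := by positivity
  obtain ⟨s, hs, hsm⟩ := exists_isometry_norm_sub_lt_of_mem_spectrum hpi (ℜ B).2 hm (half_pos hη)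
  have hδ : 0 < min (ε / 4) (η / 2 / C) := by positivity
  obtain ⟨t, ht, μ, hμ⟩ := exists_isometry_forall_norm_sub_smul_lt hpi
    (fun i => star s * a i * s) Finset.univ hδ
  have hst : ∀ x, star t * (star s * x * s) * t = star (s * t) * x * (s * t) := fun x => by
    simp only [star_mul, mul_assoc]
  simp only [hst] at hμ
  have hμK : μ ∈ approxCompressions a (ε / 2) := by
    refine ⟨s * t, lt_of_le_of_lt ((pi_norm_le_iff_of_nonneg (r := ε / 4) (by positivity)).2
      fun i => ?_) (by linarith)⟩
    exact (hμ i (Finset.mem_univ _)).le.trans (min_le_left _ _)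
  have hlt := hfu μ (subset_closure hμK)
  have h1 : ‖star (s * t) * B * (s * t) - f μ • 1‖ < η / 2 := by
    calc _ = ‖∑ i, c i • (star (s * t) * a i * (s * t) - μ i • 1)‖ := by
          simp only [hf, B, smul_sub, Finset.sum_sub_distrib, Finset.mul_sum, Finset.sum_mul,
            Finset.sum_smul, mul_smul_comm, smul_mul_assoc, mul_smul]
      _ ≤ ∑ i, ‖c i‖ * (η / 2 / C) := norm_sum_le_of_le _ fun i hi => by
          rw [norm_smul]
          gcongr
          exact (hμ i hi).le.trans (min_le_right _ _)
      _ = (C - 1) * (η / 2 / C) := by rw [← Finset.sum_mul]; simp [C]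
      _ < C * (η / 2 / C) := by
          have : 0 < η / 2 / C := by positivity
          nlinarith
      _ = η / 2 := by field_simp
  have h2 : ‖star (s * t) * (ℜ B : A) * (s * t) - ((f μ).re : ℂ) • 1‖ < η / 2 := by
    refine lt_of_le_of_lt (le_of_eq_of_le ?_ (realPart.norm_le _)) h1
    change _ = ‖((ℜ _ : selfAdjoint A) : A)‖
    rw [map_sub, AddSubgroupClass.coe_sub, realPart_star_mul_mul,
      realPart_smul]
    simp [(IsSelfAdjoint.one A).imaginaryPart]
  have h3 : ‖star (s * t) * (ℜ B : A) * (s * t) - (m : ℂ) • 1‖ < η / 2 := by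
    rw [← hst]
    refine (norm_star_mul_mul_sub_smul_le ht _ _).trans_lt ?_
    simpa [Algebra.algebraMap_eq_smul_one] using hsm
  have h4 : ‖((m : ℂ) - (f μ).re) • (1 : A)‖ < η := by
    calc _ = ‖(star (s * t) * (ℜ B : A) * (s * t) - ((f μ).re : ℂ) • 1) -
          (star (s * t) * (ℜ B : A) * (s * t) - (m : ℂ) • 1)‖ := by
          rw [sub_smul]; congr 1; abel
      _ ≤ _ := norm_sub_le _ _
      _ < η := by linarith
  rw [norm_smul, CStarRing.norm_one, mul_one, ← Complex.ofReal_sub, Complex.norm_real] at h4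
  have := (abs_lt.1 h4).2
  simp only [η] at this
  linarith

lemma exists_isometry_forall_norm_sub_state_smul_lt [Nontrivial A]
    (hpi : ∀ x : A, x ≠ 0 → ∃ a b : A, a * x * b = 1) (hsc : ∃ x : A, ∀ c : ℂ, x ≠ c • (1 : A))
    {ω : A →ₗ[ℂ] ℂ} (hω1 : ω 1 = 1)
    (hωpos : ∀ x : A, ∃ r : ℝ, 0 ≤ r ∧ ω (star x * x) = (r : ℂ))
    {ε : ℝ} (hε : 0 < ε) (F : Finset A) :
    ∃ y : A, star y * y = 1 ∧ ∀ a ∈ F, ‖star y * a * y - ω a • 1‖ < ε := by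
  classical
  set M := 1 + ∑ a ∈ F, ‖ω a‖
  have hM : 0 < M := by positivity
  have hδ : 0 < min (1 / 2) (ε / (4 * M)) := by positivity
  obtain ⟨s, hs⟩ := state_mem_approxCompressions hpi hsc hω1 hωpos
    (fun i : ↥(insert 1 F) => (i : A)) hδ
  set δ := min (1 / 2) (ε / (4 * M))
  have hsF : ∀ a ∈ insert 1 F, ‖star s * a * s - ω a • 1‖ < δ := fun a ha =>
    (norm_le_pi_norm (fun i : ↥(insert 1 F) => star s * (i : A) * s - ω i • (1 : A))
      ⟨a, ha⟩).trans_lt hs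
  have hs1 : ‖star s * s - 1‖ < δ := by simpa [hω1] using hsF 1 (Finset.mem_insert_self _ _)
  obtain ⟨d, hd, hd1, hdn⟩ := exists_isSelfAdjoint_mul_star_mul_self_mul_eq_one
    (z := s) (c := 1 / 2) (by norm_num) fun t ht => by
      have hsa : IsSelfAdjoint (star s * s) := .star_mul_self s
      have h := norm_apply_le_norm_cfc (fun t : ℝ => t - 1) (star s * s) ht
      rw [cfc_sub .., cfc_id' ℝ (star s * s), cfc_const_one ℝ (star s * s), Real.norm_eq_abs] at h
      linarith [(abs_le.1 h).1, min_le_left (1 / 2) (ε / (4 * M))]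
  have hd2 : ‖d‖ * ‖d‖ ≤ 2 := by
    calc _ ≤ (√(1 / 2))⁻¹ * (√(1 / 2))⁻¹ := by gcongr
      _ = 2 := by rw [← mul_inv, Real.mul_self_sqrt (by norm_num)]; norm_num
  refine ⟨s * d, ?_, fun a ha => ?_⟩
  · rw [← hd1, star_mul, hd.star_eq]
    simp only [mul_assoc]
  have hωM : 1 + ‖ω a‖ ≤ M := by
    have := Finset.single_le_sum (f := fun a => ‖ω a‖) (fun _ _ => norm_nonneg _) ha
    simp only [M]
    linarith
  have hb : ‖(star s * a * s - ω a • 1) - ω a • (star s * s - 1)‖ ≤ M * δ := by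
    calc _ ≤ ‖star s * a * s - ω a • 1‖ + ‖ω a • (star s * s - 1)‖ := norm_sub_le _ _
      _ ≤ δ + ‖ω a‖ * δ := by
        rw [norm_smul]
        gcongr
        exact (hsF a (Finset.mem_insert_of_mem ha)).le
      _ = (1 + ‖ω a‖) * δ := by ring
      _ ≤ M * δ := by gcongr
  calc _ = ‖d * ((star s * a * s - ω a • 1) - ω a • (star s * s - 1)) * d‖ := by
        congr 1
        rw [← hd1, star_mul, hd.star_eq]
        simp only [smul_sub, mul_sub, sub_mul, mul_smul_comm, smul_mul_assoc, mul_assoc]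
        abel
    _ ≤ ‖d‖ * (M * δ) * ‖d‖ := by
        refine (norm_mul_le _ _).trans ?_
        gcongr
        refine (norm_mul_le _ _).trans ?_
        gcongr
    _ = ‖d‖ * ‖d‖ * (M * δ) := by ring
    _ ≤ 2 * (M * (ε / (4 * M))) := by
        gcongr
        exact min_le_right _ _
    _ = ε / 2 := by field_simp; norm_num
    _ < ε := half_lt_self hε

end CStarAlgebra

/-- Let `A` be a unital purely infinite simple C*-algebra and `ω` a state
on `A`.  For every `ε > 0` and finite `F ⊆ A` there is a nonzero projection `p ∈ A` with
`‖p·a·p − ω(a)·p‖ < ε` for all `a ∈ F`. -/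
theorem stmt_6 {A : Type*} [NormedRing A] [StarRing A] [CStarRing A] [CompleteSpace A]
    [NormedAlgebra ℂ A] [StarModule ℂ A]
    (hnontriv : ∃ x : A, ∀ c : ℂ, x ≠ c • (1 : A))
    (hpi : ∀ x : A, x ≠ 0 → ∃ a b : A, a * x * b = 1)
    (ω : A →ₗ[ℂ] ℂ) (hω1 : ω 1 = 1)
    (hωpos : ∀ x : A, ∃ r : ℝ, 0 ≤ r ∧ ω (star x * x) = (r : ℂ))
    (ε : ℝ) (hε : 0 < ε) (F : Finset A) :
    ∃ p : A, p ≠ 0 ∧ IsSelfAdjoint p ∧ p * p = p ∧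
      ∀ a ∈ F, ‖p * a * p - ω a • p‖ < ε := by
  let _ : CStarAlgebra A := {}
  have : Nontrivial A := by
    obtain ⟨x, hx⟩ := hnontriv
    exact ⟨x, 0, by simpa using hx 0⟩
  obtain ⟨y, hy, hyF⟩ := CStarAlgebra.exists_isometry_forall_norm_sub_state_smul_lt
    hpi hnontriv hω1 hωpos hε F
  have hyn : ‖star y‖ ≤ 1 := by
    rw [norm_star]
    exact CStarAlgebra.norm_le_one_of_star_mul_self hy
  refine ⟨y * star y, fun h => ?_, .mul_star_self y, ?_, fun a ha => ?_⟩
  · have h1 : star y * (y * star y) * y = 1 := by rw [← mul_assoc, hy, one_mul, hy]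
    simp [h] at h1
  · rw [mul_assoc, ← mul_assoc (star y), hy, one_mul]
  · refine lt_of_le_of_lt (le_of_eq_of_le ?_
      (CStarAlgebra.norm_star_mul_mul_le hyn hyn (star y * a * y - ω a • 1))) (hyF a ha)
    congr 1
    simp only [star_star, mul_sub, sub_mul, mul_smul_comm, smul_mul_assoc, mul_one, mul_assoc]
end

section
/- Let A be a unital purely infinite simple C*-algebra, let T : A → M_n(ℂ) be a unital completely positive map, and let φ : M_n(ℂ) → A be a ∗-homomorphism (not necessarily unital). Then for every ε > 0 and every finite subset F ⊆ A there exists a partial isometry s ∈ A such that s*·s = φ(1) and ‖s*·a·s − φ(T(a))‖ < ε for all a ∈ F. -/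
/-- A square matrix over a ∗-ring is positive if it is of the form `Yᴴ·Y`.
(In a C*-algebra this is the usual notion of positivity.) -/
def MatPos {R : Type*} [NonUnitalSemiring R] [StarRing R] {k : ℕ}
    (X : Matrix (Fin k) (Fin k) R) : Prop :=
  ∃ Y : Matrix (Fin k) (Fin k) R, X = star Y * Y

/-- A linear map between C*-algebras is completely positive if all of its entrywise
amplifications to matrix algebras map positive matrices to positive matrices. -/
def IsCP {A B : Type*} [NonUnitalSemiring A] [StarRing A] [Module ℂ A]
    [NonUnitalSemiring B] [StarRing B] [Module ℂ B] (T : A →ₗ[ℂ] B) : Prop :=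
  ∀ (k : ℕ) (X : Matrix (Fin k) (Fin k) A), MatPos X → MatPos (X.map fun x => T x)

namespace PurelyInfinite

section CStar

variable {A : Type*} [CStarAlgebra A]

/-- If the spectrum of a self-adjoint `h` lies within `δ ≤ 1/2` of `1`, then `h ^ (-1/2)` lies
within `2δ` of `1`. -/
lemma norm_cfc_inv_sqrt_sub_one_le {h : A} (hh : IsSelfAdjoint h) {δ : ℝ} (hδ : δ ≤ 1 / 2)
    (hδ0 : 0 ≤ δ) (hs : ∀ x ∈ spectrum ℝ h, |x - 1| ≤ δ) :
    ‖cfc (fun x : ℝ => (√x)⁻¹) h - 1‖ ≤ 2 * δ := by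
  have hcont : ContinuousOn (fun x : ℝ => (√x)⁻¹) (spectrum ℝ h) := by
    refine Real.continuous_sqrt.continuousOn.inv₀ fun x hx => ?_
    have := abs_le.1 (hs x hx)
    exact (Real.sqrt_pos.2 (by linarith)).ne'
  rw [← cfc_one ℝ h, ← cfc_sub _ _ h hcont (by fun_prop)]
  refine norm_cfc_le (by positivity) fun x hx => ?_
  have hx1 := abs_le.1 (hs x hx)
  have hpos : 0 < √x := Real.sqrt_pos.2 (by linarith)
  have hsq : √x * √x = x := Real.mul_self_sqrt (by linarith)
  have h2 : 1 / 2 ≤ √x := by nlinarith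
  have key : (√x)⁻¹ - 1 = (1 - x) / (√x * (1 + √x)) := by
    field_simp
    nlinarith
  simp only [Pi.one_apply]
  rw [Real.norm_eq_abs, key, abs_div, abs_of_pos (by positivity : 0 < √x * (1 + √x)),
    div_le_iff₀ (by positivity), abs_sub_comm]
  have := hs x hx
  nlinarith

lemma cfc_inv_sqrt_conj {h : A} (hh : IsSelfAdjoint h) (hs : ∀ x ∈ spectrum ℝ h, 0 < x) :
    cfc (fun x : ℝ => (√x)⁻¹) h * h * cfc (fun x : ℝ => (√x)⁻¹) h = 1 := by
  have hcont : ContinuousOn (fun x : ℝ => (√x)⁻¹) (spectrum ℝ h) :=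
    Real.continuous_sqrt.continuousOn.inv₀ fun x hx => (Real.sqrt_pos.2 (hs x hx)).ne'
  have hid : ContinuousOn (fun x : ℝ => x) (spectrum ℝ h) := continuousOn_id
  conv_lhs => enter [1, 2]; rw [← cfc_id' ℝ h]
  have hmul : ContinuousOn (fun x : ℝ => (√x)⁻¹ * x) (spectrum ℝ h) := hcont.mul hid
  rw [← cfc_mul _ _ h hcont hid, ← cfc_mul _ _ h hmul hcont,
    ← cfc_one ℝ h]
  refine cfc_congr fun x hx => ?_
  have hpos := Real.sqrt_pos.2 (hs x hx)
  have hsq : √x * √x = x := Real.mul_self_sqrt (hs x hx).le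
  simp only [Pi.one_apply]
  field_simp
  nlinarith

lemma star_cfc_inv_sqrt (h : A) :
    star (cfc (fun x : ℝ => (√x)⁻¹) h) = cfc (fun x : ℝ => (√x)⁻¹) h :=
  (cfc_predicate (p := IsSelfAdjoint) _ h).star_eq

/-- A left invertible element can be multiplied on the right to become an isometry. -/
lemma exists_isometry_of_left_inverse {a y : A} (h : a * y = 1) :
    ∃ g : A, star (y * g) * (y * g) = 1 := by
  let _ := CStarAlgebra.spectralOrder A
  let _ := CStarAlgebra.spectralOrderedRing A
  have hle : 1 ≤ (‖a‖ ^ 2) • (star y * y) := by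
    have h1 := star_left_conjugate_le_conjugate
      (CStarAlgebra.star_mul_le_algebraMap_norm_sq (a := a)) y
    have h2 : star y * (star a * a) * y = 1 := by
      rw [← mul_assoc, ← star_mul, mul_assoc, h, star_one, one_mul]
    rw [h2, Algebra.algebraMap_eq_smul_one, mul_smul_comm, smul_mul_assoc, mul_one] at h1
    exact h1
  have hu : IsUnit (star y * y) := by
    nontriviality A
    have h0 : ‖a‖ ≠ 0 := by
      rintro h0
      rw [norm_eq_zero] at h0
      simp [h0] at h
    have := CStarAlgebra.isUnit_of_le 1 hle
    have h3 : star y * y = (‖a‖ ^ 2)⁻¹ • ((‖a‖ ^ 2) • (star y * y)) := by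
      rw [smul_smul, inv_mul_cancel₀ (by positivity), one_smul]
    rw [h3]
    have h4 := this.smul (Units.mk0 ((‖a‖ ^ 2)⁻¹) (by positivity))
    simpa only [Units.smul_mk0] using h4
  have hnn : 0 ≤ star y * y := star_mul_self_nonneg y
  have hs : ∀ x ∈ spectrum ℝ (star y * y), 0 < x := fun x hx =>
    lt_of_le_of_ne (spectrum_nonneg_of_nonneg hnn hx) fun h0 =>
      spectrum.zero_notMem ℝ hu (h0 ▸ hx)
  refine ⟨cfc (fun x : ℝ => (√x)⁻¹) (star y * y), ?_⟩
  have := cfc_inv_sqrt_conj (.of_nonneg hnn) hs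
  rw [star_mul, star_cfc_inv_sqrt]
  simpa only [mul_assoc] using this

lemma norm_star_conj_le {t : A} (ht : star t * t = 1) (x : A) : ‖star t * x * t‖ ≤ ‖x‖ := by
  nontriviality A
  have h1 : ‖t‖ = 1 := by
    have := CStarRing.norm_star_mul_self (x := t)
    rw [ht, CStarRing.norm_one] at this
    nlinarith [norm_nonneg t]
  calc ‖star t * x * t‖ ≤ ‖star t‖ * ‖x‖ * ‖t‖ := norm_mul₃_le
    _ = ‖x‖ := by rw [norm_star, h1]; ring

lemma star_conj_smul_one {t : A} (ht : star t * t = 1) (c : ℂ) :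
    star t * (c • (1 : A)) * t = c • 1 := by
  rw [mul_smul_comm, mul_one, smul_mul_assoc, ht]

lemma star_mul_self_mul_isometry {t u : A} (ht : star t * t = 1) (hu : star u * u = 1) :
    star (t * u) * (t * u) = 1 := by
  rw [star_mul, mul_assoc, ← mul_assoc (star t), ht, one_mul, hu]

lemma exists_isometry_mul (hpi : ∀ x : A, x ≠ 0 → ∃ a b : A, a * x * b = 1) {x : A}
    (hx : x ≠ 0) : ∃ r : A, star (x * r) * (x * r) = 1 := by
  obtain ⟨a, b, h⟩ := hpi x hx
  obtain ⟨g, hg⟩ := exists_isometry_of_left_inverse (a := a) (y := x * b) (by rwa [← mul_assoc])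
  exact ⟨b * g, by rwa [← mul_assoc x]⟩

/-- A bump function at a spectral value has nonzero functional calculus. -/
lemma cfc_bump_ne_zero [Nontrivial A] {h : A} (hh : IsSelfAdjoint h) {l : ℝ}
    (hl : l ∈ spectrum ℝ h) {ε : ℝ} (hε : 0 < ε) :
    cfc (fun x : ℝ => max 0 (ε - |x - l|)) h ≠ 0 := by
  intro h0
  have h1 := norm_apply_le_norm_cfc (fun x : ℝ => max 0 (ε - |x - l|)) h hl
  rw [h0, norm_zero] at h1
  simp [abs_of_pos hε, max_eq_right hε.le] at h1
  linarith

lemma exists_isometry_conj_near_spectrum [Nontrivial A]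
    (hpi : ∀ x : A, x ≠ 0 → ∃ a b : A, a * x * b = 1)
    {h : A} (hh : IsSelfAdjoint h) {l : ℝ} (hl : l ∈ spectrum ℝ h) {ε : ℝ} (hε : 0 < ε) :
    ∃ t : A, star t * t = 1 ∧ ‖star t * h * t - (l : ℂ) • 1‖ ≤ ε := by
  obtain ⟨r, hr⟩ := exists_isometry_mul hpi (cfc_bump_ne_zero hh hl hε)
  set x := cfc (fun x : ℝ => max 0 (ε - |x - l|)) h with hx
  refine ⟨x * r, hr, ?_⟩
  set k := cfc (fun x : ℝ => max (-ε) (min ε (x - l))) h with hk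
  have hkx : (h - (l : ℂ) • 1) * x = k * x := by
    have e1 : h - (l : ℂ) • 1 = cfc (fun x : ℝ => x - l) h := by
      rw [cfc_sub _ _ h (by fun_prop) (by fun_prop), cfc_id' ℝ h, cfc_const l h,
        Algebra.algebraMap_eq_smul_one]
      simp
    rw [e1, hx, hk, ← cfc_mul _ _ h (by fun_prop) (by fun_prop),
      ← cfc_mul _ _ h (by fun_prop) (by fun_prop)]
    refine cfc_congr fun y _ => ?_
    rcases le_or_gt ε |y - l| with h1 | h1
    · simp [max_eq_left (sub_nonpos.2 h1)]
    · have := abs_lt.1 h1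
      simp [min_eq_right this.2.le, max_eq_right this.1.le]
  have hkn : ‖k‖ ≤ ε := by
    refine norm_cfc_le hε.le fun y _ => ?_
    rw [Real.norm_eq_abs, abs_le]
    exact ⟨le_max_left _ _, max_le (by linarith) (min_le_left _ _)⟩
  have : star (x * r) * h * (x * r) - (l : ℂ) • 1 = star (x * r) * k * (x * r) := by
    rw [← star_conj_smul_one hr, ← sub_mul, ← mul_sub, mul_assoc, ← mul_assoc _ x, hkx]
    simp only [mul_assoc]
  rw [this]
  exact (norm_star_conj_le hr k).trans hkn

lemma exists_isometry_conj_near_scalar [Nontrivial A]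
    (hpi : ∀ x : A, x ≠ 0 → ∃ a b : A, a * x * b = 1) (a : A) {ε : ℝ} (hε : 0 < ε) :
    ∃ t : A, star t * t = 1 ∧ ∃ l : ℂ, ‖star t * a * t - l • 1‖ ≤ ε := by
  obtain ⟨l, hl⟩ := ContinuousFunctionalCalculus.spectrum_nonempty (R := ℝ) (p := IsSelfAdjoint)
    (realPart a : A) (realPart a).2
  obtain ⟨t, ht, htl⟩ := exists_isometry_conj_near_spectrum hpi (realPart a).2 hl (half_pos hε)
  have hsa : IsSelfAdjoint (star t * (imaginaryPart a : A) * t) :=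
    (imaginaryPart a).2.conjugate' t
  obtain ⟨m, hm⟩ := ContinuousFunctionalCalculus.spectrum_nonempty (R := ℝ) (p := IsSelfAdjoint)
    _ hsa
  obtain ⟨u, hu, hum⟩ := exists_isometry_conj_near_spectrum hpi hsa hm (half_pos hε)
  refine ⟨t * u, star_mul_self_mul_isometry ht hu, l + Complex.I * m, ?_⟩
  have e : star (t * u) * a * (t * u) - (l + Complex.I * m : ℂ) • (1 : A) =
      star u * (star t * (realPart a : A) * t - (l : ℂ) • 1) * u +
      Complex.I • (star u * (star t * (imaginaryPart a : A) * t) * u - (m : ℂ) • 1) := by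
    conv_lhs => rw [← realPart_add_I_smul_imaginaryPart a]
    rw [mul_sub, sub_mul, star_conj_smul_one hu]
    simp only [star_mul, mul_add, add_mul, mul_smul_comm, smul_mul_assoc, mul_assoc, smul_sub,
      add_smul, smul_smul]
    abel
  rw [e]
  refine (norm_add_le _ _).trans ?_
  rw [norm_smul, Complex.norm_I, one_mul]
  linarith [norm_star_conj_le hu (star t * (realPart a : A) * t - (l : ℂ) • 1)]

lemma exists_isometry_conj_near_scalars [Nontrivial A]
    (hpi : ∀ x : A, x ≠ 0 → ∃ a b : A, a * x * b = 1) {ι : Type*} (s : Finset ι) (g : ι → A)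
    {ε : ℝ} (hε : 0 < ε) :
    ∃ t : A, star t * t = 1 ∧ ∀ i ∈ s, ∃ l : ℂ, ‖star t * g i * t - l • 1‖ ≤ ε := by
  classical
  induction s using Finset.induction_on with
  | empty => exact ⟨1, by simp, by simp⟩
  | insert i s _ ih =>
    obtain ⟨t, ht, h⟩ := ih
    obtain ⟨u, hu, l, hl⟩ := exists_isometry_conj_near_scalar hpi (star t * g i * t) hε
    have e (x : A) : star (t * u) * x * (t * u) = star u * (star t * x * t) * u := by
      simp only [star_mul, mul_assoc]
    refine ⟨t * u, star_mul_self_mul_isometry ht hu, fun j hj => ?_⟩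
    rw [e]
    rcases Finset.mem_insert.1 hj with rfl | hj
    · exact ⟨l, hl⟩
    · obtain ⟨l, hl⟩ := h j hj
      refine ⟨l, ?_⟩
      rw [← star_conj_smul_one hu, ← sub_mul, ← mul_sub]
      exact (norm_star_conj_le hu _).trans hl

/-- Finitely many elements can be simultaneously compressed by isometries to elements
arbitrarily close to fixed scalars. -/
lemma exists_scalars_forall_exists_isometry [Nontrivial A]
    (hpi : ∀ x : A, x ≠ 0 → ∃ a b : A, a * x * b = 1) {ι : Type*} [Fintype ι] (g : ι → A) :
    ∃ l : ι → ℂ, ∀ ε : ℝ, 0 < ε →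
      ∃ t : A, star t * t = 1 ∧ ∀ i, ‖star t * g i * t - l i • 1‖ ≤ ε := by
  have hpos (k : ℕ) : (0 : ℝ) < 1 / (k + 1) := by positivity
  choose t ht h using fun k : ℕ =>
    exists_isometry_conj_near_scalars hpi Finset.univ g (hpos k)
  choose m hm using fun k i => h k i (Finset.mem_univ i)
  have hle (k : ℕ) : (1 : ℝ) / (k + 1) ≤ 1 := by
    rw [div_le_one (by positivity)]; linarith [k.cast_nonneg (α := ℝ)]
  have hmem (k : ℕ) : m k ∈ Set.univ.pi fun i => Metric.closedBall (0 : ℂ) (‖g i‖ + 1) := by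
    intro i _
    rw [mem_closedBall_zero_iff]
    have h1 : ‖m k i • (1 : A)‖ = ‖m k i‖ := by rw [norm_smul, CStarRing.norm_one, mul_one]
    rw [← h1]
    have h2 := norm_sub_norm_le (m k i • (1 : A)) (star (t k) * g i * t k)
    rw [norm_sub_rev] at h2
    linarith [hm k i, hle k, norm_star_conj_le (ht k) (g i)]
  obtain ⟨l, -, φ, hφ, hl⟩ := (isCompact_univ_pi fun i =>
    isCompact_closedBall (0 : ℂ) (‖g i‖ + 1)).tendsto_subseq hmem
  refine ⟨l, fun ε hε => ?_⟩
  have e1 : ∀ᶠ k in Filter.atTop, (1 : ℝ) / ((φ k : ℕ) + 1) < ε / 2 :=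
    (tendsto_one_div_add_atTop_nhds_zero_nat.comp hφ.tendsto_atTop).eventually
      (gt_mem_nhds (half_pos hε))
  have e2 := Metric.tendsto_nhds.1 hl _ (half_pos hε)
  obtain ⟨k, hk1, hk2⟩ := (e1.and e2).exists
  refine ⟨t (φ k), ht _, fun i => ?_⟩
  have h3 : ‖(m (φ k) i - l i) • (1 : A)‖ ≤ ε / 2 := by
    rw [norm_smul, CStarRing.norm_one, mul_one, ← dist_eq_norm]
    exact (dist_le_pi_dist _ _ i).trans hk2.le
  calc _ = ‖(star (t (φ k)) * g i * t (φ k) - m (φ k) i • 1) + (m (φ k) i - l i) • 1‖ := by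
        rw [sub_smul]; abel_nf
    _ ≤ _ := norm_add_le _ _
    _ ≤ ε := by linarith [hm (φ k) i]

lemma exists_orthogonal_isometries [Nontrivial A]
    (hpi : ∀ x : A, x ≠ 0 → ∃ a b : A, a * x * b = 1) (hnt : ∃ x : A, ∀ c : ℂ, x ≠ c • (1 : A)) :
    ∃ u v : A, star u * u = 1 ∧ star v * v = 1 ∧ star u * v = 0 := by
  obtain ⟨h, hh, hns⟩ : ∃ h : A, IsSelfAdjoint h ∧ ∀ c : ℝ, h ≠ algebraMap ℝ A c := by
    by_contra! H
    obtain ⟨x, hx⟩ := hnt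
    obtain ⟨c, hc⟩ := H _ (realPart x).2
    obtain ⟨d, hd⟩ := H _ (imaginaryPart x).2
    refine hx (c + Complex.I * d) ?_
    rw [← realPart_add_I_smul_imaginaryPart x, hc, hd, Algebra.algebraMap_eq_smul_one,
      Algebra.algebraMap_eq_smul_one, add_smul, mul_smul, Complex.coe_smul, Complex.coe_smul]
  obtain ⟨l, hl⟩ := ContinuousFunctionalCalculus.spectrum_nonempty (R := ℝ) (p := IsSelfAdjoint)
    h hh
  obtain ⟨m, hm, hlm⟩ : ∃ m ∈ spectrum ℝ h, m ≠ l := by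
    by_contra! H
    refine hns l ?_
    rw [← cfc_id' ℝ h, ← cfc_const l h]
    exact cfc_congr fun x hx => H x hx
  have hε : 0 < |m - l| / 2 := half_pos (abs_pos.2 (sub_ne_zero.2 hlm))
  obtain ⟨r, hr⟩ := exists_isometry_mul hpi (cfc_bump_ne_zero hh hl hε)
  obtain ⟨s, hs⟩ := exists_isometry_mul hpi (cfc_bump_ne_zero hh hm hε)
  refine ⟨_, _, hr, hs, ?_⟩
  rw [star_mul, (cfc_predicate (p := IsSelfAdjoint) _ h).star_eq, mul_assoc, ← mul_assoc (cfc _ h),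
    ← cfc_mul _ _ h (by fun_prop) (by fun_prop)]
  convert! mul_zero (star r)
  convert! zero_mul s
  rw [← cfc_zero ℝ h]
  refine cfc_congr fun x _ => ?_
  simp only [Pi.zero_apply, mul_eq_zero]
  by_contra! H
  have h1 : 0 < |m - l| / 2 - |x - l| := by
    by_contra! h; exact H.1 (max_eq_left h)
  have h2 : 0 < |m - l| / 2 - |x - m| := by
    by_contra! h; exact H.2 (max_eq_left h)
  have := abs_sub_le m x l
  rw [abs_sub_comm m x] at this
  linarith

variable {ι m : Type*}

/-- The arrays `l` of scalars such that, for some tuple `v`, the elements `v j⋆ · a i · v k` are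
arbitrarily close to the scalars `l (i, j, k)`. -/
def approxSet (a : ι → A) : Set (ι × m × m → ℂ) :=
  {l | ∀ ε : ℝ, 0 < ε → ∃ v : m → A, ∀ p, ‖star (v p.2.1) * a p.1 * v p.2.2 - l p • 1‖ ≤ ε}

lemma zero_mem_approxSet (a : ι → A) : (0 : ι × m × m → ℂ) ∈ approxSet a :=
  fun ε hε => ⟨0, fun p => by simpa using hε.le⟩

lemma smul_mem_approxSet {a : ι → A} {l : ι × m × m → ℂ} (hl : l ∈ approxSet a) {c : ℝ}
    (hc : 0 ≤ c) : c • l ∈ approxSet a := by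
  intro ε hε
  obtain ⟨v, hv⟩ := hl (ε / (c + 1)) (by positivity)
  refine ⟨√c • v, fun p => ?_⟩
  have e : star ((√c • v) p.2.1) * a p.1 * (√c • v) p.2.2 - (c • l) p • 1 =
      c • (star (v p.2.1) * a p.1 * v p.2.2 - l p • 1) := by
    simp only [Pi.smul_apply, star_smul, smul_mul_assoc, mul_smul_comm, smul_smul, smul_sub,
      star_trivial, Real.mul_self_sqrt hc, smul_assoc]
  rw [e, norm_smul, Real.norm_of_nonneg hc]
  calc c * _ ≤ c * (ε / (c + 1)) := by gcongr; exact hv p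
    _ ≤ ε := by
      rw [mul_div_assoc', div_le_iff₀ (by positivity)]
      nlinarith

lemma add_mem_approxSet [Nontrivial A] [Finite ι] [Finite m]
    (hpi : ∀ x : A, x ≠ 0 → ∃ a b : A, a * x * b = 1) (hnt : ∃ x : A, ∀ c : ℂ, x ≠ c • (1 : A))
    {a : ι → A} {l l' : ι × m × m → ℂ} (hl : l ∈ approxSet a) (hl' : l' ∈ approxSet a) :
    l + l' ∈ approxSet a := by
  have := Fintype.ofFinite ι
  have := Fintype.ofFinite m
  intro ε hε
  obtain ⟨v, hv⟩ := hl (ε / 4) (by positivity)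
  obtain ⟨v', hv'⟩ := hl' (ε / 4) (by positivity)
  obtain ⟨μ, hμ⟩ := exists_scalars_forall_exists_isometry hpi
    (Sum.elim (fun p : ι × m × m => star (v p.2.1) * a p.1 * v' p.2.2)
      fun p : ι × m × m => star (v' p.2.1) * a p.1 * v p.2.2)
  obtain ⟨t, ht, h⟩ := hμ (ε / 4) (by positivity)
  obtain ⟨x, y, hx, hy, hxy⟩ := exists_orthogonal_isometries hpi hnt
  have hyx : star y * x = 0 := by rw [← star_star x, ← star_mul, hxy, star_zero]
  have cross {x y g : A} {c : ℂ} (hx : star x * x = 1) (hy : star y * y = 1)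
      (hxy : star x * y = 0) (hg : ‖g - c • 1‖ ≤ ε / 4) : ‖star x * g * y‖ ≤ ε / 4 := by
    have e : star x * g * y = star x * (g - c • 1) * y := by
      rw [mul_sub, sub_mul, mul_smul_comm, mul_one, smul_mul_assoc, hxy, smul_zero, sub_zero]
    have n1 {x : A} (hx : star x * x = 1) : ‖x‖ = 1 := by
      have := CStarRing.norm_star_mul_self (x := x)
      rw [hx, CStarRing.norm_one] at this
      nlinarith [norm_nonneg x]
    rw [e]
    refine norm_mul₃_le.trans ?_
    rwa [norm_star, n1 hx, n1 hy, one_mul, mul_one]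
  refine ⟨fun j => v j * t * x + v' j * t * y, fun p => ?_⟩
  have htx := star_mul_self_mul_isometry ht hx
  have hty := star_mul_self_mul_isometry ht hy
  have e : star (v p.2.1 * t * x + v' p.2.1 * t * y) * a p.1 * (v p.2.2 * t * x + v' p.2.2 * t * y)
      - (l + l') p • 1 =
      star (t * x) * (star (v p.2.1) * a p.1 * v p.2.2 - l p • 1) * (t * x) +
      star (t * y) * (star (v' p.2.1) * a p.1 * v' p.2.2 - l' p • 1) * (t * y) +
      star x * (star t * (star (v p.2.1) * a p.1 * v' p.2.2) * t) * y +
      star y * (star t * (star (v' p.2.1) * a p.1 * v p.2.2) * t) * x := by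
    rw [mul_sub, mul_sub, sub_mul, sub_mul, star_conj_smul_one htx, star_conj_smul_one hty]
    simp only [star_add, star_mul, Pi.add_apply, add_smul, mul_add, add_mul, mul_assoc]
    abel
  rw [e]
  refine (norm_add₄_le).trans ?_
  have h₁ (p) : ‖star t * (star (v p.2.1) * a p.1 * v' p.2.2) * t - μ (.inl p) • 1‖ ≤ ε / 4 :=
    h (.inl p)
  have h₂ (p) : ‖star t * (star (v' p.2.1) * a p.1 * v p.2.2) * t - μ (.inr p) • 1‖ ≤ ε / 4 :=
    h (.inr p)
  linarith [(norm_star_conj_le htx _).trans (hv p), (norm_star_conj_le hty _).trans (hv' p),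
    cross hx hy hxy (h₁ p), cross hy hx hyx (h₂ p)]

lemma isClosed_approxSet [Nontrivial A] [Fintype ι] [Fintype m] (a : ι → A) :
    IsClosed (approxSet a : Set (ι × m × m → ℂ)) := by
  refine isClosed_of_closure_subset fun l hl ε hε => ?_
  obtain ⟨l', hl', hd⟩ := Metric.mem_closure_iff.1 hl _ (half_pos hε)
  obtain ⟨v, hv⟩ := hl' _ (half_pos hε)
  refine ⟨v, fun p => ?_⟩
  have h3 : ‖(l' p - l p) • (1 : A)‖ ≤ ε / 2 := by
    rw [norm_smul, CStarRing.norm_one, mul_one, ← dist_eq_norm, dist_comm]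
    exact (dist_le_pi_dist _ _ p).trans hd.le
  calc _ = ‖(star (v p.2.1) * a p.1 * v p.2.2 - l' p • 1) + (l' p - l p) • 1‖ := by
        rw [sub_smul]; abel_nf
    _ ≤ _ := norm_add_le _ _
    _ ≤ ε := by linarith [hv p]

/-- A self-adjoint element that is not positive can be conjugated to a nonzero negative element. -/
lemma exists_conj_eq_neg_star_mul_self {H : A} (hH : IsSelfAdjoint H)
    (hpos : ¬ ∃ Y : A, H = star Y * Y) :
    ∃ N X : A, star N = N ∧ X ≠ 0 ∧ N * H * N = -(star X * X) := by
  let _ := CStarAlgebra.spectralOrder A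
  let _ := CStarAlgebra.spectralOrderedRing A
  have hN0 : H⁻ ≠ 0 := fun h0 =>
    hpos ((CStarAlgebra.nonneg_iff_eq_star_mul_self).1
      ((CFC.negPart_eq_zero_iff H hH).1 h0))
  have hN := CFC.negPart_nonneg H
  set N := H⁻ with hNdef
  set X := CFC.sqrt N * N with hX
  have hNsa : star N = N := (IsSelfAdjoint.of_nonneg hN).star_eq
  have hXX : star X * X = N * N * N := by
    rw [hX, star_mul, hNsa, (IsSelfAdjoint.of_nonneg (CFC.sqrt_nonneg N)).star_eq, mul_assoc,
      ← mul_assoc (CFC.sqrt N), CFC.sqrt_mul_sqrt_self N, mul_assoc]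
  have hNHN : N * H * N = -(star X * X) := by
    conv_lhs => rw [← CFC.posPart_sub_negPart H hH]
    rw [← hNdef, mul_sub, sub_mul, hXX, CFC.negPart_mul_posPart, zero_mul, zero_sub]
  have hX0 : X ≠ 0 := by
    intro h0
    rw [h0, mul_zero] at hXX
    have h1 : star (N * N) * (N * N) = 0 := by
      rw [star_mul, hNsa, ← mul_assoc, ← hXX, zero_mul]
    have h2 : star N * N = 0 := by rw [hNsa]; exact CStarRing.star_mul_self_eq_zero_iff _ |>.1 h1
    exact hN0 (CStarRing.star_mul_self_eq_zero_iff _ |>.1 h2)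
  exact ⟨N, X, hNsa, hX0, hNHN⟩

/-- A self-adjoint matrix over `A` that is not positive takes the value `-1` on some vector. -/
lemma exists_conj_eq_neg_one (hpi : ∀ x : A, x ≠ 0 → ∃ a b : A, a * x * b = 1) {n : ℕ}
    (H : CStarMatrix (Fin n) (Fin n) A) (hH : IsSelfAdjoint H)
    (hpos : ¬ ∃ Y : CStarMatrix (Fin n) (Fin n) A, H = star Y * Y) :
    ∃ w : Fin n → A, ∑ j, ∑ k, star (w j) * H j k * w k = -1 := by
  let _ := CStarAlgebra.spectralOrder A
  let _ := CStarAlgebra.spectralOrderedRing A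
  obtain ⟨N, X, hNsa, hX0, hNHN⟩ := exists_conj_eq_neg_star_mul_self hH hpos
  obtain ⟨p, q, hpq⟩ : ∃ p q, X p q ≠ 0 := by
    by_contra! h
    exact hX0 (CStarMatrix.ext h)
  set d := ∑ k, star (X k q) * X k q with hd
  have hd0 : 0 ≤ d := Finset.sum_nonneg fun k _ => star_mul_self_nonneg _
  have hdne : d ≠ 0 := by
    intro h0
    have := (Finset.sum_eq_zero_iff_of_nonneg fun k _ => star_mul_self_nonneg (X k q)).1 h0 p
      (Finset.mem_univ _)
    exact hpq (CStarRing.star_mul_self_eq_zero_iff _ |>.1 this)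
  obtain ⟨s, hs⟩ := (CStarAlgebra.nonneg_iff_eq_star_mul_self).1 hd0
  obtain ⟨r, hr⟩ := exists_isometry_mul hpi (x := s) (by rintro rfl; simp at hs; exact hdne hs)
  have hrd : star r * d * r = 1 := by
    rw [hs, ← hr, star_mul]; simp only [mul_assoc]
  have key : ∑ j, ∑ k, star (N j q) * H j k * N k q = -d := by
    have h1 := congrFun (congrFun hNHN q) q
    have hNe (j : Fin n) : star (N j q) = N q j := congrFun (congrFun hNsa q) j
    simp only [CStarMatrix.mul_apply, CStarMatrix.neg_apply, CStarMatrix.star_apply,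
      Finset.sum_mul] at h1
    simp only [hNe]
    rw [Finset.sum_comm]
    exact h1
  refine ⟨fun j => N j q * r, ?_⟩
  calc _ = star r * (∑ j, ∑ k, star (N j q) * H j k * N k q) * r := by
        simp only [Finset.mul_sum, Finset.sum_mul, star_mul, mul_assoc]
    _ = -1 := by rw [key, mul_neg, neg_mul, hrd]

/-- Completely positive maps into matrices are star-preserving. -/
lemma _root_.IsCP.map_star {n : ℕ} {T : A →ₗ[ℂ] Matrix (Fin n) (Fin n) ℂ} (hT : IsCP T) (x : A) :
    T (star x) = star (T x) := by
  let _ := CStarAlgebra.spectralOrder A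
  let _ := CStarAlgebra.spectralOrderedRing A
  have hpos (y : A) (hy : 0 ≤ y) : star (T y) = T y := by
    obtain ⟨z, rfl⟩ := (CStarAlgebra.nonneg_iff_eq_star_mul_self).1 hy
    obtain ⟨Y, hY⟩ := hT 1 (.of fun _ _ => star z * z) ⟨.of fun _ _ => z, by
      ext i j
      simp [Matrix.mul_apply, Matrix.star_apply]⟩
    have h1 : star ((Matrix.of fun _ _ : Fin 1 => star z * z).map fun x => T x) = _ :=
      congrArg star hY
    rw [star_mul, star_star, ← hY] at h1
    exact congrFun (congrFun h1 0) 0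
  have hsa (y : A) (hy : IsSelfAdjoint y) : star (T y) = T y := by
    rw [← CFC.posPart_sub_negPart y hy, map_sub, star_sub, hpos _ (CFC.posPart_nonneg y),
      hpos _ (CFC.negPart_nonneg y)]
  conv_lhs => rw [← realPart_add_I_smul_imaginaryPart x]
  conv_rhs => rw [← realPart_add_I_smul_imaginaryPart x]
  simp only [star_add, star_smul, map_add, map_smul, (realPart x).2.star_eq,
    (imaginaryPart x).2.star_eq, hsa _ (realPart x).2, hsa _ (imaginaryPart x).2]

/-- A completely positive map into matrices gives a positive functional on matrices. -/
lemma _root_.IsCP.sum_map_re_nonneg {n : ℕ} {T : A →ₗ[ℂ] Matrix (Fin n) (Fin n) ℂ} (hT : IsCP T)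
    {H : Matrix (Fin n) (Fin n) A} (hH : MatPos H) : 0 ≤ (∑ j, ∑ k, T (H j k) j k).re := by
  obtain ⟨Y, hY⟩ := hT n H hH
  have h1 (j k) : T (H j k) = ∑ i, star (Y i j) * Y i k := by
    have := congrFun (congrFun hY j) k
    simpa [Matrix.mul_apply, Matrix.star_apply] using this
  have h2 : ∑ j, ∑ k, T (H j k) j k =
      ∑ i, ∑ r, star (∑ j, Y i j r j) * ∑ k, Y i k r k := by
    simp only [h1, Matrix.sum_apply, Matrix.mul_apply, Matrix.star_apply, star_sum,
      Finset.sum_mul_sum]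
    calc _ = ∑ j, ∑ i, ∑ r, ∑ k, star (Y i j r j) * Y i k r k := by
          refine Finset.sum_congr rfl fun j _ => ?_
          rw [Finset.sum_comm]
          exact Finset.sum_congr rfl fun i _ => Finset.sum_comm
      _ = _ := by
          rw [Finset.sum_comm]
          exact Finset.sum_congr rfl fun i _ => Finset.sum_comm
  rw [h2, Complex.re_sum]
  refine Finset.sum_nonneg fun i _ => ?_
  rw [Complex.re_sum]
  refine Finset.sum_nonneg fun r _ => ?_
  rw [Complex.star_def, ← Complex.normSq_eq_conj_mul_self, Complex.ofReal_re]
  exact Complex.normSq_nonneg _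

/-- If `b` is a matrix at which the functional of a completely positive map has negative real
part, then `b` takes a value with real part `-1` on some vector. -/
lemma exists_real_part_conj_eq_neg_one (hpi : ∀ x : A, x ≠ 0 → ∃ a b : A, a * x * b = 1) {n : ℕ}
    {T : A →ₗ[ℂ] Matrix (Fin n) (Fin n) ℂ} (hT : IsCP T) (b : Fin n → Fin n → A)
    (hb : (∑ j, ∑ k, T (b j k) j k).re < 0) :
    ∃ w : Fin n → A, (∑ j, ∑ k, star (w j) * b j k * w k) +
      star (∑ j, ∑ k, star (w j) * b j k * w k) = -1 := by
  let _ := CStarAlgebra.spectralOrder A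
  let _ := CStarAlgebra.spectralOrderedRing A
  let H : CStarMatrix (Fin n) (Fin n) A :=
    CStarMatrix.ofMatrix (.of fun j k => b j k + star (b k j))
  have hHe (j k) : H j k = b j k + star (b k j) := rfl
  have hH : IsSelfAdjoint H := by
    refine CStarMatrix.ext fun j k => ?_
    rw [CStarMatrix.star_apply, hHe, hHe, star_add, star_star, add_comm]
  have hneg : (∑ j, ∑ k, T (H j k) j k).re < 0 := by
    have : ∑ j, ∑ k, T (H j k) j k =
        (∑ j, ∑ k, T (b j k) j k) + star (∑ j, ∑ k, T (b j k) j k) := by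
      simp only [hHe, map_add, hT.map_star, Matrix.add_apply, Matrix.star_apply,
        Finset.sum_add_distrib, star_sum]
      congr 1
      exact Finset.sum_comm
    rw [this, Complex.add_re, Complex.star_def, Complex.conj_re]
    linarith
  obtain ⟨w, hw⟩ := exists_conj_eq_neg_one hpi H hH fun ⟨Y, hY⟩ =>
    not_le.2 hneg (hT.sum_map_re_nonneg (H := H) ⟨Y, hY⟩)
  refine ⟨w, ?_⟩
  rw [← hw]
  simp only [hHe, mul_add, add_mul, Finset.sum_add_distrib, star_sum, star_mul, star_star,
    mul_assoc]
  congr 1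
  exact Finset.sum_comm

lemma sum_prod_prod_rotate {κ M : Type*} [Fintype ι] [Fintype m] [Fintype κ] [AddCommMonoid M]
    (g : ι × m × κ → M) : ∑ p, g p = ∑ j, ∑ k, ∑ i, g (i, j, k) := by
  rw [Fintype.sum_prod_type, Finset.sum_comm, Fintype.sum_prod_type]

lemma map_mem_approxSet [Nontrivial A] (hpi : ∀ x : A, x ≠ 0 → ∃ a b : A, a * x * b = 1)
    (hnt : ∃ x : A, ∀ c : ℂ, x ≠ c • (1 : A)) [Fintype ι] {n : ℕ}
    {T : A →ₗ[ℂ] Matrix (Fin n) (Fin n) ℂ} (hT : IsCP T) (a : ι → A) :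
    (fun p => T (a p.1) p.2.1 p.2.2) ∈ (approxSet a : Set (ι × Fin n × Fin n → ℂ)) := by
  classical
  by_contra hmem
  have hconv : Convex ℝ (approxSet a : Set (ι × Fin n × Fin n → ℂ)) :=
    fun l hl l' hl' s t hs ht _ =>
      add_mem_approxSet hpi hnt (smul_mem_approxSet hl hs) (smul_mem_approxSet hl' ht)
  obtain ⟨f, u, hfu, huf⟩ :=
    RCLike.geometric_hahn_banach_closed_point (𝕜 := ℂ) hconv (isClosed_approxSet a) hmem
  simp only [RCLike.re_to_complex] at hfu huf
  have hu : 0 < u := by simpa using hfu 0 (zero_mem_approxSet a)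
  have hle (l) (hl : l ∈ approxSet a) : (f l).re ≤ 0 := by
    by_contra! h
    have h1 := hfu _ (smul_mem_approxSet hl (div_pos hu h).le)
    rw [← Complex.coe_smul, map_smul, smul_eq_mul, Complex.re_ofReal_mul,
      div_mul_cancel₀ _ h.ne'] at h1
    exact lt_irrefl _ h1
  set c : ι × Fin n × Fin n → ℂ := fun p => f (Pi.single p 1) with hc
  have hf (l) : f l = ∑ p, c p * l p := by
    conv_lhs => rw [← Finset.univ_sum_single l, map_sum]
    refine Finset.sum_congr rfl fun p _ => ?_
    rw [← mul_one (l p), ← smul_eq_mul (l p), Pi.single_smul, map_smul, smul_eq_mul, smul_eq_mul,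
      mul_one, mul_comm]
  set b : Fin n → Fin n → A := fun j k => -∑ i, c (i, j, k) • a i with hb
  have hbneg : (∑ j, ∑ k, T (b j k) j k).re < 0 := by
    have : ∑ j, ∑ k, T (b j k) j k = -f fun p => T (a p.1) p.2.1 p.2.2 := by
      rw [hf, sum_prod_prod_rotate]
      simp [hb, Matrix.sum_apply]
    rw [this, Complex.neg_re]
    linarith
  obtain ⟨w, hw⟩ := exists_real_part_conj_eq_neg_one hpi hT b hbneg
  obtain ⟨l, hl⟩ := exists_scalars_forall_exists_isometry hpi
    fun p : ι × Fin n × Fin n => star (w p.2.1) * a p.1 * w p.2.2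
  have hlC : l ∈ approxSet a := fun ε hε => by
    obtain ⟨t, -, h⟩ := hl ε hε
    refine ⟨fun j => w j * t, fun p => ?_⟩
    have := h p
    simpa only [star_mul, mul_assoc] using this
  set K := ∑ p, ‖c p‖ with hK
  have hK0 : 0 ≤ K := Finset.sum_nonneg fun _ _ => norm_nonneg _
  obtain ⟨t, ht, h⟩ := hl (1 / (4 * (K + 1))) (by positivity)
  set B := ∑ j, ∑ k, star (w j) * b j k * w k with hB
  have hBe : B = -∑ p : ι × Fin n × Fin n, c p • (star (w p.2.1) * a p.1 * w p.2.2) := by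
    rw [hB, sum_prod_prod_rotate]
    simp [hb, Finset.mul_sum, Finset.sum_mul]
  have h1 : ‖star t * B * t + f l • 1‖ ≤ 1 / 4 := by
    have e : star t * B * t + f l • 1 = -∑ p : ι × Fin n × Fin n,
        c p • (star t * (star (w p.2.1) * a p.1 * w p.2.2) * t - l p • 1) := by
      rw [hBe, hf]
      simp only [smul_sub, Finset.sum_sub_distrib, smul_smul, ← Finset.sum_smul, mul_neg, neg_mul,
        Finset.mul_sum, Finset.sum_mul, mul_smul_comm, smul_mul_assoc]
      abel
    rw [e, norm_neg]
    refine (norm_sum_le _ _).trans ?_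
    calc _ ≤ ∑ p, ‖c p‖ * (1 / (4 * (K + 1))) := by
          refine Finset.sum_le_sum fun p _ => ?_
          rw [norm_smul]
          gcongr
          exact h p
      _ = K / (4 * (K + 1)) := by rw [← Finset.sum_mul, ← hK, mul_one_div]
      _ ≤ 1 / 4 := by
          rw [div_le_div_iff₀ (by positivity) (by positivity)]
          linarith
  have h2 : (star t * B * t + f l • 1) + star (star t * B * t + f l • 1) =
      ((-1 + 2 * (f l).re : ℝ) : ℂ) • (1 : A) := by
    have e1 : star t * B * t + star (star t * B * t) = -1 := by
      have : star (star t * B * t) = star t * star B * t := by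
        simp only [star_mul, star_star, mul_assoc]
      rw [this, ← add_mul, ← mul_add, hw, mul_neg, neg_mul, mul_one, ht]
    have e2 : ((-1 + 2 * (f l).re : ℝ) : ℂ) = -1 + (f l + star (f l)) := by
      rw [Complex.star_def, Complex.add_conj]; push_cast; ring
    rw [e2, add_smul, add_smul, neg_smul, one_smul, ← e1, star_add, star_smul, star_one]
    abel
  have h3 : |(-1 + 2 * (f l).re)| ≤ 1 / 4 + 1 / 4 := by
    have : ‖((-1 + 2 * (f l).re : ℝ) : ℂ) • (1 : A)‖ = |(-1 + 2 * (f l).re)| := by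
      rw [norm_smul, CStarRing.norm_one, mul_one, Complex.norm_real, Real.norm_eq_abs]
    rw [← this, ← h2]
    refine (norm_add_le _ _).trans ?_
    rw [norm_star]
    linarith
  linarith [hle l hlC, (abs_le.1 h3).1]

/-- If `s⋆s` is close to a projection `p` and `s = s p`, then multiplying `s` by some self-adjoint
element close to `1` turns it into a partial isometry with initial projection `p`. -/
lemma exists_mul_partial_isometry {p s : A} (hp : star p = p) (hpp : p * p = p) (hsp : s * p = s)
    {δ : ℝ} (hδ : δ ≤ 1 / 2) (h : ‖star s * s - p‖ ≤ δ) :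
    ∃ g : A, star g = g ∧ ‖g - 1‖ ≤ 2 * δ ∧ star (s * g) * (s * g) = p := by
  set k := star s * s + (1 - p) with hk
  have hps : p * star s = star s := by rw [← hp, ← star_mul, hsp]
  have hksa : IsSelfAdjoint k := by
    rw [IsSelfAdjoint, hk, star_add, star_mul, star_star, star_sub, star_one, hp]
  have hkp : Commute k p := by
    have h1 : star s * s * p = star s * s := by rw [mul_assoc, hsp]
    have h2 : p * (star s * s) = star s * s := by rw [← mul_assoc, hps]
    rw [Commute, SemiconjBy, hk, add_mul, mul_add, h1, h2, sub_mul, mul_sub, one_mul, mul_one]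
  have hk1 : k * (1 - p) = 1 - p := by
    have h1 : (1 - p) * (1 - p) = 1 - p := IsIdempotentElem.one_sub hpp
    rw [hk, add_mul, mul_sub, mul_one, mul_assoc (star s) s p, hsp, sub_self, zero_add, h1]
  have hspec : ∀ x ∈ spectrum ℝ k, |x - 1| ≤ δ := fun x hx => by
    have h1 := norm_apply_le_norm_cfc (fun x : ℝ => x - 1) k hx
    rw [cfc_sub _ _ k (by fun_prop) (by fun_prop), cfc_id' ℝ k, cfc_const_one ℝ k] at h1
    refine h1.trans ?_
    rw [hk, add_sub_assoc, sub_sub_cancel_left, ← sub_eq_add_neg]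
    exact h
  set g := cfc (fun x : ℝ => (√x)⁻¹) k with hg
  have hgp : Commute g p := hkp.cfc_real _
  have hgs : star g = g := star_cfc_inv_sqrt k
  have hgkg : g * k * g = 1 := cfc_inv_sqrt_conj hksa fun x hx => by
    linarith [(abs_le.1 (hspec x hx)).1]
  refine ⟨g, hgs, norm_cfc_inv_sqrt_sub_one_le hksa hδ ((norm_nonneg _).trans h) hspec, ?_⟩
  have h1 : g * (1 - p) * g = 1 - p := by
    rw [← hk1, mul_assoc, mul_assoc, ((Commute.one_left g).sub_left hgp.symm).eq, ← mul_assoc k,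
      ← mul_assoc, ← mul_assoc, hgkg, one_mul, hk1]
  calc star (s * g) * (s * g) = g * k * g - g * (1 - p) * g := by
        rw [star_mul, hgs, hk]; noncomm_ring
    _ = p := by rw [hgkg, h1, sub_sub_cancel]

/-- Assembling the entries `v i⋆ · a · v j ≈ T(a) i j` into an element implementing `φ ∘ T`. -/
lemma norm_star_sum_mul_sub_map_le {n : ℕ} (φ : Matrix (Fin n) (Fin n) ℂ →⋆ₙₐ[ℂ] A) (o : Fin n)
    (v : Fin n → A) (a : A) (M : Matrix (Fin n) (Fin n) ℂ) {η : ℝ}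
    (h : ∀ i j, ‖star (v i) * a * v j - M i j • 1‖ ≤ η) :
    ‖star (∑ i, v i * φ (Matrix.single o i 1)) * a * (∑ i, v i * φ (Matrix.single o i 1)) - φ M‖ ≤
      η * ∑ i, ∑ j, ‖φ (Matrix.single i o 1)‖ * ‖φ (Matrix.single o j 1)‖ := by
  have hstar (i) : star (φ (Matrix.single o i 1)) = φ (Matrix.single i o 1) := by
    rw [← map_star, Matrix.star_eq_conjTranspose, Matrix.conjTranspose_single, star_one]
  have hM : φ M = ∑ i, ∑ j, φ (Matrix.single i o 1) * (M i j • 1) * φ (Matrix.single o j 1) := by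
    conv_lhs => rw [Matrix.matrix_eq_sum_single M]
    simp only [map_sum, mul_smul_comm, mul_one, smul_mul_assoc]
    refine Finset.sum_congr rfl fun i _ => Finset.sum_congr rfl fun j _ => ?_
    rw [← map_mul, ← map_smul, Matrix.single_mul_single_same, Matrix.smul_single, mul_one,
      smul_eq_mul, mul_one]
  have e : star (∑ i, v i * φ (Matrix.single o i 1)) * a * (∑ i, v i * φ (Matrix.single o i 1)) -
      φ M = ∑ i, ∑ j, φ (Matrix.single i o 1) * (star (v i) * a * v j - M i j • 1) *
        φ (Matrix.single o j 1) := by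
    rw [hM]
    simp only [mul_sub, sub_mul, Finset.sum_sub_distrib, star_sum, star_mul, hstar, Finset.sum_mul,
      Finset.mul_sum, mul_assoc]
    congr 1
    exact Finset.sum_comm
  rw [e, Finset.mul_sum]
  refine (norm_sum_le _ _).trans (Finset.sum_le_sum fun i _ => ?_)
  rw [Finset.mul_sum]
  refine (norm_sum_le _ _).trans (Finset.sum_le_sum fun j _ => norm_mul₃_le.trans ?_)
  rw [mul_right_comm, mul_comm]
  gcongr
  exact h i j

/-- The main theorem for bundled C⋆-algebras. -/
theorem exists_partial_isometry_conj_near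
    (hnt : ∃ x : A, ∀ c : ℂ, x ≠ c • (1 : A))
    (hpi : ∀ x : A, x ≠ 0 → ∃ a b : A, a * x * b = 1)
    (n : ℕ) (T : A →ₗ[ℂ] Matrix (Fin n) (Fin n) ℂ) (hT1 : T 1 = 1) (hT : IsCP T)
    (φ : Matrix (Fin n) (Fin n) ℂ →⋆ₙₐ[ℂ] A) (ε : ℝ) (hε : 0 < ε) (F : Finset A) :
    ∃ s : A, star s * s = φ 1 ∧ ∀ a ∈ F, ‖star s * a * s - φ (T a)‖ < ε := by
  classical
  have : Nontrivial A := by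
    obtain ⟨x, hx⟩ := hnt
    exact ⟨x, 0, by simpa using hx 0⟩
  rcases n with _ | n
  · have h0 (M : Matrix (Fin 0) (Fin 0) ℂ) : φ M = 0 := by rw [Subsingleton.elim M 0, map_zero]
    exact ⟨0, by simp [h0], fun a _ => by simpa [h0] using hε⟩
  set K := ∑ i : Fin (n + 1), ∑ j : Fin (n + 1),
    ‖φ (Matrix.single i 0 1)‖ * ‖φ (Matrix.single 0 j 1)‖
  have hK : 0 ≤ K := Finset.sum_nonneg fun _ _ => Finset.sum_nonneg fun _ _ => by positivity
  set M := ∑ a ∈ F, ‖φ (T a)‖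
  have hM : 0 ≤ M := Finset.sum_nonneg fun _ _ => norm_nonneg _
  set δ := min (1 / 2) (ε / (2 * (4 + 6 * M))) with hδ
  have hδ0 : 0 < δ := lt_min (by norm_num) (by positivity)
  have hδ1 : δ ≤ 1 / 2 := min_le_left _ _
  have hδ2 : δ * (4 + 6 * M) < ε := by
    have h1 : δ ≤ ε / (2 * (4 + 6 * M)) := min_le_right _ _
    rw [le_div_iff₀ (by positivity)] at h1
    linarith
  obtain ⟨v, hv⟩ := map_mem_approxSet hpi hnt hT
    (fun x : {x // x ∈ insert 1 F} => (x : A)) (δ / (K + 1)) (by positivity)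
  set s := ∑ i, v i * φ (Matrix.single 0 i 1) with hs
  have hsa (a : A) (ha : a ∈ insert 1 F) : ‖star s * a * s - φ (T a)‖ ≤ δ := by
    refine (norm_star_sum_mul_sub_map_le φ 0 v a (T a) (η := δ / (K + 1))
      fun i j => hv (⟨a, ha⟩, i, j)).trans ?_
    rw [div_mul_eq_mul_div, div_le_iff₀ (by positivity)]
    gcongr
    linarith
  have hs1 : ‖star s * s - φ 1‖ ≤ δ := by
    simpa [hT1] using hsa 1 (Finset.mem_insert_self _ _)
  obtain ⟨g, hgs, hg1, hg⟩ := exists_mul_partial_isometry (p := φ 1) (s := s)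
    (by rw [← map_star, star_one]) (by rw [← map_mul, one_mul])
    (by simp only [hs, Finset.sum_mul, mul_assoc, ← map_mul, mul_one]) hδ1 hs1
  refine ⟨s * g, hg, fun a ha => ?_⟩
  have hg2 : ‖g‖ ≤ 2 := by
    have := norm_le_norm_add_norm_sub' g 1
    rw [CStarRing.norm_one] at this
    linarith
  have hY : ‖φ (T a)‖ ≤ M :=
    Finset.single_le_sum (f := fun a => ‖φ (T a)‖) (fun _ _ => norm_nonneg _) ha
  have e : star (s * g) * a * (s * g) - φ (T a) = g * (star s * a * s - φ (T a)) * g +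
      (g - 1) * φ (T a) * g + φ (T a) * (g - 1) := by
    rw [star_mul, hgs]; noncomm_ring
  rw [e]
  calc _ ≤ ‖g‖ * ‖star s * a * s - φ (T a)‖ * ‖g‖ + ‖g - 1‖ * ‖φ (T a)‖ * ‖g‖ +
        ‖φ (T a)‖ * ‖g - 1‖ := by
        refine norm_add₃_le.trans ?_
        gcongr
        exacts [norm_mul₃_le, norm_mul₃_le, norm_mul_le _ _]
    _ ≤ 2 * δ * 2 + 2 * δ * M * 2 + M * (2 * δ) := by
      gcongr
      exact hsa a (Finset.mem_insert_of_mem ha)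
    _ = δ * (4 + 6 * M) := by ring
    _ < ε := hδ2

end CStar

end PurelyInfinite

/-- Let `A` be a unital purely infinite simple C*-algebra,
`T : A → M_n(ℂ)` a unital completely positive map, and `φ : M_n(ℂ) → A` a (not necessarily
unital) ∗-homomorphism.  For every `ε > 0` and finite `F ⊆ A` there is a partial isometry
`s ∈ A` with `s*·s = φ(1)` and `‖s*·a·s − φ(T(a))‖ < ε` for all `a ∈ F`. -/
theorem stmt_7 {A : Type*} [NormedRing A] [StarRing A] [CStarRing A] [CompleteSpace A]
    [NormedAlgebra ℂ A] [StarModule ℂ A]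
    (hnontriv : ∃ x : A, ∀ c : ℂ, x ≠ c • (1 : A))
    (hpi : ∀ x : A, x ≠ 0 → ∃ a b : A, a * x * b = 1)
    (n : ℕ) (T : A →ₗ[ℂ] Matrix (Fin n) (Fin n) ℂ) (hT1 : T 1 = 1) (hTcp : IsCP T)
    (φ : Matrix (Fin n) (Fin n) ℂ →⋆ₙₐ[ℂ] A)
    (ε : ℝ) (hε : 0 < ε) (F : Finset A) :
    ∃ s : A, star s * s = φ 1 ∧ ∀ a ∈ F, ‖star s * a * s - φ (T a)‖ < ε := by
  let _ : CStarAlgebra A := { }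
  exact PurelyInfinite.exists_partial_isometry_conj_near hnontriv hpi n T hT1 hTcp φ ε hε F
end
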